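/- arXiv:0807.0537 — 8 statements merged into one kernel-verified Lean document; each statement's English description precedes it below -/
import Mathlib

section
/- Ikehara's Tauberian theorem: Suppose the Dirichlet series f(z) = ∑_{n=1}^∞ a_n / n^z with coefficients a_n ≥ 0 converges for every complex z = x + iy with x > 1, and suppose there is a constant A such that the function g(z) = f(z) − A/(z − 1), defined for x > 1, has a continuous extension to the closed half-plane {x ≥ 1}. Then the partial sums s_N = ∑_{n ≤ N} a_n satisfy s_N / N → A as N → ∞. -/
open Filter Finset
noncomputable def fK (w : ℝ) : ℝ := (Real.sinc (w/2))^2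
lemma fK_nonneg (w : ℝ) : 0 ≤ fK w := sq_nonneg _
lemma fK_cont : Continuous fK := by unfold fK; fun_prop
lemma fK_le (w : ℝ) : fK w ≤ 5 * (1 + w^2)⁻¹ := by
  unfold fK
  have h1 : (Real.sinc (w/2))^2 ≤ 1 := by
    rw [sq_le_one_iff_abs_le_one]
    exact Real.abs_sinc_le_one _
  have h2 : w^2 * (Real.sinc (w/2))^2 ≤ 4 := by
    by_cases hw : w = 0
    · simp [hw]
    · rw [Real.sinc_of_ne_zero (by positivity)]
      have := Real.sin_sq_le_one (w/2)
      field_simp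
      nlinarith
  rw [← div_eq_mul_inv, le_div_iff₀ (by positivity)]
  nlinarith
lemma fK_int : MeasureTheory.Integrable fK := by
  refine (integrable_inv_one_add_sq.const_mul 5).mono' fK_cont.aestronglyMeasurable ?_
  filter_upwards with w
  rw [Real.norm_of_nonneg (fK_nonneg w)]
  exact fK_le w
lemma fK_pos : 0 < ∫ w, fK w := by
  rw [MeasureTheory.integral_pos_iff_support_of_nonneg fK_nonneg fK_int]
  exact fK_cont.isOpen_support.measure_pos MeasureTheory.volume ⟨0, by simp [fK]⟩
lemma fK_fourier (w : ℝ) : ∫ t in (-1:ℝ)..1, ((1 - |t| : ℝ) : ℂ) * Complex.exp (Complex.I * t * w) = (fK w : ℂ) := by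
  have hc : Continuous fun t : ℝ => ((1 - |t| : ℝ) : ℂ) * Complex.exp (Complex.I * t * w) := by fun_prop
  have hc' : Continuous fun t : ℝ => ((1 - |-t| : ℝ) : ℂ) * Complex.exp (Complex.I * (-t:ℝ) * w) := by fun_prop
  rw [← intervalIntegral.integral_add_adjacent_intervals (b := 0) (hc.intervalIntegrable _ _) (hc.intervalIntegrable _ _)]
  have h1 := intervalIntegral.integral_comp_neg (a := 0) (b := 1) (fun t : ℝ => ((1 - |t| : ℝ) : ℂ) * Complex.exp (Complex.I * t * w))
  rw [neg_zero] at h1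
  rw [← h1, ← intervalIntegral.integral_add (hc'.intervalIntegrable _ _) (hc.intervalIntegrable _ _)]
  have h2 : ∫ t in (0:ℝ)..1, (((1 - |-t| : ℝ) : ℂ) * Complex.exp (Complex.I * (-t:ℝ) * w) + ((1 - |t| : ℝ) : ℂ) * Complex.exp (Complex.I * t * w)) = ∫ t in (0:ℝ)..1, ((2 * ((1 - t) * Real.cos (t * w)) : ℝ) : ℂ) := by
    apply intervalIntegral.integral_congr
    intro t ht
    rw [Set.uIcc_of_le zero_le_one] at ht
    simp only [abs_neg, abs_of_nonneg ht.1]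
    push_cast
    rw [Complex.cos]
    ring_nf
  rw [h2, intervalIntegral.integral_ofReal]
  congr 1
  rw [intervalIntegral.integral_const_mul]
  by_cases hw : w = 0
  · subst hw
    have : ∫ x in (0:ℝ)..1, (1 - x) = 1/2 := by
      rw [intervalIntegral.integral_sub (by simp) (by simp)]
      simp; norm_num
    simp [fK, this]
  · have h3 : ∫ t in (0:ℝ)..1, (1 - t) * Real.cos (t * w) = ((1-1) * Real.sin (1*w) / w - Real.cos (1*w)/w^2) - ((1-0) * Real.sin (0*w) / w - Real.cos (0*w)/w^2) := by
      apply intervalIntegral.integral_eq_sub_of_hasDerivAt (f := fun t => (1-t) * Real.sin (t*w) / w - Real.cos (t*w)/w^2)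
      · intro t _
        have hl : HasDerivAt (fun t : ℝ => t * w) w t := by simpa using (hasDerivAt_id t).mul_const w
        have hm : HasDerivAt (fun t : ℝ => 1 - t) (-1) t := by simpa using (hasDerivAt_id t).const_sub 1
        have := ((hm.mul hl.sin).div_const w).sub (hl.cos.div_const (w^2))
        refine this.congr_deriv ?_
        field_simp
        ring
      · apply Continuous.intervalIntegrable; fun_prop
    rw [h3]
    unfold fK
    rw [Real.sinc_of_ne_zero (by positivity)]
    have h4 : Real.cos w = 1 - 2 * Real.sin (w/2)^2 := by
      rw [← Real.cos_sq_add_sin_sq (w/2)]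
      have := Real.cos_two_mul (w/2)
      rw [mul_div_cancel₀ _ two_ne_zero] at this
      rw [this]
      nlinarith [Real.cos_sq_add_sin_sq (w/2)]
    simp [h4]
    field_simp
    ring
open MeasureTheory Topology

lemma fK_comp_int {l : ℝ} (hl : 0 < l) (v : ℝ) : Integrable (fun u => fK (l * (v - u))) := by
  have := (fK_int.comp_mul_left' hl.ne').comp_sub_left v
  exact this

lemma fK_comp_integral {l : ℝ} (hl : 0 < l) (v : ℝ) : ∫ u, fK (l * (v - u)) = l⁻¹ * ∫ w, fK w := by
  have h := integral_sub_left_eq_self (fun u => fK (l * u)) volume v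
  rw [h, Measure.integral_comp_mul_left, abs_of_pos (inv_pos.2 hl), smul_eq_mul]

lemma fK_comp_interval {l : ℝ} (hl : 0 < l) (v d : ℝ) :
    ∫ u in (v-d)..(v+d), fK (l * (v - u)) = l⁻¹ * ∫ w in (-(l*d))..(l*d), fK w := by
  have h := intervalIntegral.integral_comp_sub_mul (a := v-d) (b := v+d) fK hl.ne' (l*v)
  rw [smul_eq_mul] at h
  convert h using 4 <;> ring

lemma step1 (B : ℝ → ℝ) (A : ℝ) (G : ℝ → ℝ → ℂ) (ε : ℝ) 
    (hint : IntegrableOn (fun u => (B u - A) * Real.exp (-(ε * u))) (Set.Ioi 0))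
    (hL : ∀ t : ℝ, ∫ u in Set.Ioi (0:ℝ), (((B u - A) * Real.exp (-(ε * u)) : ℝ) : ℂ) *
      Complex.exp (-(Complex.I * t * u)) = G ε t) (l v : ℝ) :
    ((∫ u in Set.Ioi (0:ℝ), (B u - A) * Real.exp (-(ε * u)) * fK (l * (v - u)) : ℝ) : ℂ) =
      ∫ t in (-1:ℝ)..1, ((1 - |t| : ℝ) : ℂ) * Complex.exp (Complex.I * (l * v * t)) * G ε (l * t) := by
  rw [← integral_complex_ofReal]
  have h1 : ∀ u : ℝ, (((B u - A) * Real.exp (-(ε * u)) * fK (l * (v - u)) : ℝ) : ℂ) =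
      ∫ t in (-1:ℝ)..1, (((B u - A) * Real.exp (-(ε * u)) : ℝ) : ℂ) * (((1 - |t| : ℝ) : ℂ) * Complex.exp (Complex.I * t * (l * (v - u) : ℝ))) := by
    intro u
    rw [intervalIntegral.integral_const_mul, fK_fourier, Complex.ofReal_mul]
  simp_rw [h1, intervalIntegral.integral_of_le (show (-1:ℝ) ≤ 1 by norm_num)]
  rw [integral_integral_swap]
  · refine integral_congr_ae (Eventually.of_forall fun t => ?_)
    simp only
    rw [← hL, ← integral_const_mul]
    refine integral_congr_ae (Eventually.of_forall fun u => ?_)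
    simp only
    have : Complex.exp (Complex.I * t * (l * (v - u) : ℝ)) = Complex.exp (Complex.I * (l * v * t)) * Complex.exp (-(Complex.I * (l * t : ℝ) * u)) := by
      rw [← Complex.exp_add]
      congr 1
      push_cast
      ring
    rw [this]
    ring
  · have hp : Integrable (fun t : ℝ => (1:ℝ)) (volume.restrict (Set.Ioc (-1:ℝ) 1)) := by
      simp
    have h2 := (hint.ofReal (𝕜 := ℂ)).mul_prod (hp.ofReal (𝕜 := ℂ))
    refine h2.mul_bdd (c := 1) (g := fun p : ℝ × ℝ => (((1 - |p.2| : ℝ) : ℂ) * Complex.exp (Complex.I * p.2 * (l * (v - p.1) : ℝ)))) ?_ ?_ |>.congr ?_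
    · apply Continuous.aestronglyMeasurable
      fun_prop
    · rw [Measure.prod_restrict]
      filter_upwards [ae_restrict_mem (measurableSet_Ioi.prod measurableSet_Ioc)] with p hp
      have h3 := hp.2
      have : ‖Complex.exp (Complex.I * p.2 * (l * (v - p.1) : ℝ))‖ = 1 := by
        rw [mul_assoc, mul_comm, ← Complex.ofReal_mul, Complex.norm_exp_ofReal_mul_I]
      rw [norm_mul, this, mul_one, Complex.norm_real, Real.norm_eq_abs]
      have h4 : |p.2| ≤ 1 := abs_le.2 ⟨h3.1.le, h3.2⟩
      rw [abs_le]
      constructor <;> linarith [abs_nonneg p.2]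
    · filter_upwards with p
      simp [Function.uncurry]

lemma step2 (G : ℝ → ℝ → ℂ) (hG : ContinuousOn (Function.uncurry G) (Set.Ici 0 ×ˢ Set.univ)) (l v : ℝ) :
    Tendsto (fun ε => ∫ t in (-1:ℝ)..1, ((1 - |t| : ℝ) : ℂ) * Complex.exp (Complex.I * (l * v * t)) * G ε (l * t)) (𝓝[>] 0)
     (𝓝 (∫ t in (-1:ℝ)..1, ((1 - |t| : ℝ) : ℂ) * Complex.exp (Complex.I * (l * v * t)) * G 0 (l * t))) := by
  have hcomp : IsCompact (Set.Icc (0:ℝ) 1 ×ˢ Set.Icc (-|l|) |l|) := isCompact_Icc.prod isCompact_Icc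
  obtain ⟨C, hC⟩ := hcomp.exists_bound_of_continuousOn (hG.mono (Set.prod_mono (fun x hx => hx.1) (Set.subset_univ _)))
  have hIoo : Set.Ioo (0:ℝ) 1 ∈ 𝓝[>] (0:ℝ) := Ioo_mem_nhdsGT one_pos
  apply intervalIntegral.tendsto_integral_filter_of_dominated_convergence (fun _ => C)
  · filter_upwards [hIoo] with ε hε
    apply Continuous.aestronglyMeasurable
    have hGc : Continuous fun t : ℝ => G ε (l * t) := by
      have := hG.comp_continuous (f := fun t : ℝ => (ε, l * t)) (by fun_prop) (fun t => ⟨hε.1.le, trivial⟩)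
      exact this
    refine Continuous.mul ?_ hGc
    fun_prop
  · filter_upwards [hIoo] with ε hε
    filter_upwards with t ht
    rw [Set.uIoc_of_le (by norm_num)] at ht
    have h4 : |t| ≤ 1 := abs_le.2 ⟨ht.1.le, ht.2⟩
    have e1 : ‖Complex.exp (Complex.I * (l * v * t))‖ = 1 := by
      rw [mul_comm, ← Complex.ofReal_mul, ← Complex.ofReal_mul, Complex.norm_exp_ofReal_mul_I]
    have e2 : ‖G ε (l * t)‖ ≤ C := by
      refine hC (ε, l*t) ⟨⟨hε.1.le, hε.2.le⟩, ?_⟩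
      rw [Set.mem_Icc, ← abs_le, abs_mul]
      exact mul_le_of_le_one_right (abs_nonneg _) h4
    rw [norm_mul, norm_mul, e1, mul_one, Complex.norm_real, Real.norm_eq_abs]
    have e3 : |(1 - |t| : ℝ)| ≤ 1 := by rw [abs_le]; constructor <;> linarith [abs_nonneg t]
    calc _ ≤ 1 * ‖G ε (l * t)‖ := by gcongr
      _ ≤ C := by linarith
  · exact intervalIntegrable_const
  · filter_upwards with t ht
    refine Tendsto.mul tendsto_const_nhds ?_
    have h := hG (0, l*t) ⟨by simp, trivial⟩
    have : Tendsto (fun ε : ℝ => (ε, l*t)) (𝓝[>] 0) (𝓝[Set.Ici 0 ×ˢ Set.univ] (0, l*t)) := by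
      apply tendsto_nhdsWithin_of_tendsto_nhds_of_eventually_within
      · have : Continuous (fun ε : ℝ => (ε, l*t)) := by fun_prop
        exact (this.tendsto 0).mono_left nhdsWithin_le_nhds
      · filter_upwards [hIoo] with ε hε
        exact ⟨hε.1.le, trivial⟩
    exact h.tendsto.comp this

lemma step3 {l : ℝ} (hl : 0 < l) (v : ℝ) :
    Tendsto (fun ε : ℝ => ∫ u in Set.Ioi (0:ℝ), Real.exp (-(ε * u)) * fK (l * (v - u))) (𝓝[>] 0)
      (𝓝 (∫ u in Set.Ioi (0:ℝ), fK (l * (v - u)))) := by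
  apply tendsto_integral_filter_of_dominated_convergence (fun u => fK (l * (v - u)))
  · filter_upwards with ε
    apply Continuous.aestronglyMeasurable
    have := fK_cont
    fun_prop
  · filter_upwards [self_mem_nhdsWithin] with ε hε
    filter_upwards [ae_restrict_mem measurableSet_Ioi] with u hu
    rw [Real.norm_of_nonneg (mul_nonneg (Real.exp_pos _).le (fK_nonneg _))]
    apply mul_le_of_le_one_left (fK_nonneg _)
    rw [Real.exp_le_one_iff]
    have : (0:ℝ) < ε * u := mul_pos hε hu
    linarith
  · exact (fK_comp_int hl v).integrableOn
  · filter_upwards with u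
    have : Continuous fun ε : ℝ => Real.exp (-(ε * u)) * fK (l * (v - u)) := by fun_prop
    have := this.tendsto 0
    simp only [zero_mul, neg_zero, Real.exp_zero, one_mul] at this
    exact this.mono_left nhdsWithin_le_nhds

lemma step4a {l : ℝ} (hl : 0 < l) :
    Tendsto (fun v : ℝ => ∫ u in Set.Ioi (0:ℝ), fK (l * (v - u))) atTop (𝓝 (l⁻¹ * ∫ w, fK w)) := by
  have h : ∀ v : ℝ, ∫ u in Set.Ioi (0:ℝ), fK (l * (v - u)) = ∫ x in Set.Iio v, fK (l * x) := by
    intro v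
    rw [← integral_indicator measurableSet_Ioi, ← integral_indicator measurableSet_Iio, 
      ← integral_sub_left_eq_self _ volume v]
    congr 1
    ext u
    simp [Set.indicator]
  simp_rw [h]
  have h2 := fK_comp_integral hl 0
  have hi : Integrable (fun x => fK (l * x)) := fK_int.comp_mul_left' hl.ne'
  have h3 : ∫ x, fK (l * x) = l⁻¹ * ∫ w, fK w := by
    rw [Measure.integral_comp_mul_left, abs_of_pos (inv_pos.2 hl), smul_eq_mul]
  rw [← h3]
  simp_rw [← integral_Iic_eq_integral_Iio]
  exact (aecover_Iic tendsto_id).integral_tendsto_of_countably_generated hi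

lemma step4b (G : ℝ → ℝ → ℂ) {l : ℝ} (hl : 0 < l) :
    Tendsto (fun v : ℝ => ∫ t in (-1:ℝ)..1, ((1 - |t| : ℝ) : ℂ) * Complex.exp (Complex.I * (l * v * t)) * G 0 (l * t)) atTop (𝓝 0) := by
  have h := Real.tendsto_integral_exp_smul_cocompact ((Set.Ioc (-1:ℝ) 1).indicator fun t => ((1 - |t| : ℝ) : ℂ) * G 0 (l * t))
  have h2 : Tendsto (fun v : ℝ => -(l * v / (2 * Real.pi))) atTop (cocompact ℝ) := by
    refine Tendsto.mono_right ?_ atBot_le_cocompact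
    refine tendsto_neg_atTop_atBot.comp ?_
    exact (tendsto_id.const_mul_atTop hl).atTop_div_const (by positivity)
  refine (h.comp h2).congr fun v => ?_
  rw [intervalIntegral.integral_of_le (by norm_num), ← integral_indicator measurableSet_Ioc]
  simp only [Function.comp]
  congr 1
  ext t
  by_cases ht : t ∈ Set.Ioc (-1:ℝ) 1
  · simp only [Set.indicator_of_mem ht]
    rw [Circle.smul_def, Real.fourierChar_apply, smul_eq_mul]
    have : (((2 * Real.pi * -(t * -(l * v / (2 * Real.pi))) : ℝ) : ℂ) * Complex.I) = Complex.I * (l * v * t) := by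
      have : 2 * Real.pi * -(t * -(l * v / (2 * Real.pi))) = l * v * t := by
        field_simp
      rw [this]; push_cast; ring
    rw [this]
    ring
  · simp [Set.indicator_of_notMem ht]
lemma fK_le5 (w : ℝ) : fK w ≤ 5 := by
  refine (fK_le w).trans ?_
  have : (1 + w^2)⁻¹ ≤ 1 := inv_le_one_of_one_le₀ (by nlinarith [sq_nonneg w])
  linarith

lemma mulK_int {h : ℝ → ℝ} {s : Set ℝ} (hh : IntegrableOn h s) (l v : ℝ) :
    IntegrableOn (fun u => h u * fK (l * (v - u))) s := by
  refine Integrable.mul_bdd (c := 5) hh ?_ ?_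
  · apply Continuous.aestronglyMeasurable
    have := fK_cont
    fun_prop
  · filter_upwards with u
    rw [Real.norm_of_nonneg (fK_nonneg _)]
    exact fK_le5 _

lemma keyL (B : ℝ → ℝ) (A : ℝ) (G : ℝ → ℝ → ℂ) 
    (hG : ContinuousOn (Function.uncurry G) (Set.Ici 0 ×ˢ Set.univ))
    (hint : ∀ ε : ℝ, 0 < ε → IntegrableOn (fun u => B u * Real.exp (-(ε * u))) (Set.Ioi 0))
    (hL : ∀ ε : ℝ, 0 < ε → ∀ t : ℝ, ∫ u in Set.Ioi (0:ℝ), (((B u - A) * Real.exp (-(ε * u)) : ℝ) : ℂ) *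
      Complex.exp (-(Complex.I * t * u)) = G ε t) {l : ℝ} (hl : 0 < l) :
    ∃ L : ℝ → ℝ, Tendsto L atTop (𝓝 (A * (l⁻¹ * ∫ w, fK w))) ∧ 
      ∀ v, Tendsto (fun ε : ℝ => ∫ u in Set.Ioi (0:ℝ), B u * Real.exp (-(ε * u)) * fK (l * (v - u)))
        (𝓝[>] 0) (𝓝 (L v)) := by
  refine ⟨fun v => A * (∫ u in Set.Ioi (0:ℝ), fK (l * (v - u))) + (∫ t in (-1:ℝ)..1, ((1 - |t| : ℝ) : ℂ) * Complex.exp (Complex.I * (l * v * t)) * G 0 (l * t)).re, ?_, ?_⟩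
  · have h1 := (step4a hl).const_mul A
    have h2 := (Complex.continuous_re.tendsto _).comp (step4b G hl)
    simpa using h1.add h2
  · intro v
    have h1 := (step3 hl v).const_mul A
    have h2 := (Complex.continuous_re.tendsto _).comp (step2 G hG l v)
    refine (h1.add h2).congr' ?_
    filter_upwards [self_mem_nhdsWithin] with ε hε
    have hε : 0 < ε := hε
    have he : IntegrableOn (fun u => Real.exp (-(ε * u))) (Set.Ioi 0) := by
      simpa using exp_neg_integrableOn_Ioi 0 hε
    have hi : IntegrableOn (fun u => (B u - A) * Real.exp (-(ε * u))) (Set.Ioi 0) := by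
      refine ((hint ε hε).sub (he.const_mul A)).congr ?_
      filter_upwards with u
      simp only [Pi.sub_apply]
      ring
    have h3 := step1 B A G ε hi (hL ε hε) l v
    simp only [Function.comp]
    rw [← h3, Complex.ofReal_re, ← integral_const_mul, ← integral_add ((mulK_int he l v).const_mul A) (mulK_int hi l v)]
    congr 1
    ext u
    ring

lemma upper (B : ℝ → ℝ) (hB : ∀ u, 0 ≤ B u) (hm : ∀ u w, u ≤ w → B u ≤ B w * Real.exp (w - u))
    (hint : ∀ ε : ℝ, 0 < ε → IntegrableOn (fun u => B u * Real.exp (-(ε * u))) (Set.Ioi 0))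
    {l : ℝ} (hl : 0 < l) {v d L : ℝ} (hd : 0 < d) (hv : d < v)
    (hL : Tendsto (fun ε : ℝ => ∫ u in Set.Ioi (0:ℝ), B u * Real.exp (-(ε * u)) * fK (l * (v - u)))
        (𝓝[>] 0) (𝓝 L)) :
    B (v - d) * Real.exp (-(2*d)) * (l⁻¹ * ∫ w in (-(l*d))..(l*d), fK w) ≤ L := by
  have hc : Tendsto (fun ε : ℝ => B (v - d) * Real.exp (-(2*d)) * Real.exp (-(ε * (v + d))) * (l⁻¹ * ∫ w in (-(l*d))..(l*d), fK w)) (𝓝[>] 0)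
      (𝓝 (B (v - d) * Real.exp (-(2*d)) * (l⁻¹ * ∫ w in (-(l*d))..(l*d), fK w))) := by
    have : Continuous (fun ε : ℝ => B (v - d) * Real.exp (-(2*d)) * Real.exp (-(ε * (v + d))) * (l⁻¹ * ∫ w in (-(l*d))..(l*d), fK w)) := by fun_prop
    have := this.tendsto 0
    simp only [zero_mul, neg_zero, Real.exp_zero, mul_one] at this
    exact this.mono_left nhdsWithin_le_nhds
  refine le_of_tendsto_of_tendsto hc hL ?_
  filter_upwards [self_mem_nhdsWithin] with ε hε
  have hε : 0 < ε := hε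
  have hsub : Set.Ioc (v - d) (v + d) ⊆ Set.Ioi 0 := fun u hu => by
    have := hu.1
    simp only [Set.mem_Ioi]; linarith
  have hi := mulK_int (hint ε hε) l v
  rw [← fK_comp_interval hl v, intervalIntegral.integral_of_le (by linarith), ← integral_const_mul]
  calc _ ≤ ∫ u in Set.Ioc (v - d) (v + d), B u * Real.exp (-(ε * u)) * fK (l * (v - u)) := by
        refine setIntegral_mono_on ((fK_comp_int hl v).integrableOn.const_mul _) (hi.mono_set hsub) measurableSet_Ioc ?_
        intro u hu
        have h1 := hm (v - d) u hu.1.le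
        have h2 : Real.exp (u - (v - d)) ≤ Real.exp (2*d) := Real.exp_le_exp.2 (by linarith [hu.2])
        have h3 : Real.exp (-(ε * (v + d))) ≤ Real.exp (-(ε * u)) := Real.exp_le_exp.2 (by nlinarith [hu.2])
        have h4 : B (v - d) * Real.exp (-(2*d)) ≤ B u := by
          rw [Real.exp_neg, ← div_eq_mul_inv, div_le_iff₀ (Real.exp_pos _)]
          exact h1.trans (mul_le_mul_of_nonneg_left h2 (hB u))
        have := fK_nonneg (l * (v - u))
        have := hB u
        gcongr
    _ ≤ _ := by
        refine setIntegral_mono_set hi ?_ hsub.eventuallyLE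
        filter_upwards with u
        exact mul_nonneg (mul_nonneg (hB u) (Real.exp_pos _).le) (fK_nonneg _)

lemma lower (B : ℝ → ℝ) (hB : ∀ u, 0 ≤ B u) (hm : ∀ u w, u ≤ w → B u ≤ B w * Real.exp (w - u))
    (hint : ∀ ε : ℝ, 0 < ε → IntegrableOn (fun u => B u * Real.exp (-(ε * u))) (Set.Ioi 0))
    {M : ℝ} (hM : ∀ u, 0 ≤ u → B u ≤ M)
    {l : ℝ} (hl : 0 < l) {v d L : ℝ} (hd : 0 < d)
    (hL : Tendsto (fun ε : ℝ => ∫ u in Set.Ioi (0:ℝ), B u * Real.exp (-(ε * u)) * fK (l * (v - u)))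
        (𝓝[>] 0) (𝓝 L)) :
    L ≤ l⁻¹ * (M * ((∫ w, fK w) - ∫ w in (-(l*d))..(l*d), fK w) + B (v + d) * Real.exp (2*d) * ∫ w in (-(l*d))..(l*d), fK w) := by
  have hM0 : 0 ≤ M := (hB 0).trans (hM 0 le_rfl)
  refine le_of_tendsto hL ?_
  filter_upwards [self_mem_nhdsWithin] with ε hε
  have hε : 0 < ε := hε
  have hi := mulK_int (hint ε hε) l v
  set C := B (v + d) * Real.exp (2*d) with hC
  have hC0 : 0 ≤ C := mul_nonneg (hB _) (Real.exp_pos _).le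
  have hK := fK_comp_int hl v
  let F : ℝ → ℝ := fun u => M * fK (l * (v - u)) + (C - M) * (Set.Ioc (v - d) (v + d)).indicator (fun u => fK (l * (v - u))) u
  have hFi : Integrable F := (hK.const_mul M).add ((hK.indicator measurableSet_Ioc).const_mul _)
  have hF : ∫ u, F u = l⁻¹ * (M * ((∫ w, fK w) - ∫ w in (-(l*d))..(l*d), fK w) + C * ∫ w in (-(l*d))..(l*d), fK w) := by
    have h1 := fK_comp_interval hl v d
    rw [intervalIntegral.integral_of_le (by linarith)] at h1
    simp only [F]
    rw [integral_add (hK.const_mul M) ((hK.indicator measurableSet_Ioc).const_mul _), integral_const_mul, integral_const_mul, integral_indicator measurableSet_Ioc, fK_comp_integral hl, h1]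
    ring
  have hFn : ∀ u, 0 ≤ F u := by
    intro u
    have := fK_nonneg (l * (v - u))
    by_cases hu : u ∈ Set.Ioc (v - d) (v + d)
    · simp only [F, Set.indicator_of_mem hu]
      nlinarith [mul_nonneg hC0 this]
    · simp only [F, Set.indicator_of_notMem hu]
      nlinarith [mul_nonneg hM0 this]
  rw [← hF]
  calc _ ≤ ∫ u in Set.Ioi 0, F u := by
        refine setIntegral_mono_on hi hFi.integrableOn measurableSet_Ioi ?_
        intro u hu0
        have hu0 : 0 < u := hu0
        have hk := fK_nonneg (l * (v - u))
        have h3 : Real.exp (-(ε * u)) ≤ 1 := Real.exp_le_one_iff.2 (by nlinarith)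
        have h4 : B u * Real.exp (-(ε * u)) ≤ B u := mul_le_of_le_one_right (hB u) h3
        by_cases hu : u ∈ Set.Ioc (v - d) (v + d)
        · simp only [F, Set.indicator_of_mem hu]
          have h5 : B u ≤ C := (hm u (v+d) hu.2).trans (mul_le_mul_of_nonneg_left (Real.exp_le_exp.2 (by linarith [hu.1])) (hB _))
          nlinarith [mul_le_mul_of_nonneg_right (h4.trans h5) hk]
        · simp only [F, Set.indicator_of_notMem hu]
          nlinarith [mul_le_mul_of_nonneg_right (h4.trans (hM u hu0.le)) hk]
    _ ≤ _ := setIntegral_le_integral hFi (Eventually.of_forall hFn)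

lemma T_tendsto : Tendsto (fun n : ℝ => ∫ w in (-n)..n, fK w) atTop (𝓝 (∫ w, fK w)) :=
  intervalIntegral_tendsto_integral fK_int tendsto_neg_atTop_atBot tendsto_id

theorem core (B : ℝ → ℝ) (hB : ∀ u, 0 ≤ B u) (hm : ∀ u w, u ≤ w → B u ≤ B w * Real.exp (w - u))
    (A : ℝ) (G : ℝ → ℝ → ℂ) 
    (hG : ContinuousOn (Function.uncurry G) (Set.Ici 0 ×ˢ Set.univ))
    (hint : ∀ ε : ℝ, 0 < ε → IntegrableOn (fun u => B u * Real.exp (-(ε * u))) (Set.Ioi 0))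
    (hL : ∀ ε : ℝ, 0 < ε → ∀ t : ℝ, ∫ u in Set.Ioi (0:ℝ), (((B u - A) * Real.exp (-(ε * u)) : ℝ) : ℂ) *
      Complex.exp (-(Complex.I * t * u)) = G ε t) : Tendsto B atTop (𝓝 A) := by
  set I := ∫ w, fK w with hI
  have hI0 : 0 < I := fK_pos
  have hexp : Tendsto (fun n : ℝ => Real.exp (-(2 * n⁻¹))) atTop (𝓝 1) := by
    have : Continuous fun x : ℝ => Real.exp (-(2 * x)) := by fun_prop
    have h := (this.tendsto 0).comp (tendsto_inv_atTop_zero (𝕜 := ℝ))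
    simpa [Function.comp_def] using h
  have hTpos : ∀ᶠ n : ℝ in atTop, 0 < ∫ w in (-n)..n, fK w := T_tendsto.eventually_const_lt hI0
  have hup : ∀ c, A < c → ∀ᶠ u in atTop, B u < c := by
    intro c hc
    have h1 : Tendsto (fun n : ℝ => c * (Real.exp (-(2 * n⁻¹)) * ∫ w in (-n)..n, fK w)) atTop (𝓝 (c * (1 * I))) :=
      (hexp.mul T_tendsto).const_mul c
    have h2 : A * I < c * (1 * I) := by nlinarith
    obtain ⟨n, hn1, hn2, hn0⟩ := ((h1.eventually_const_lt h2).and (hTpos.and (eventually_gt_atTop 0))).exists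
    have hl : 0 < n^2 := by positivity
    have hd : 0 < n⁻¹ := by positivity
    have hld : n^2 * n⁻¹ = n := by field_simp
    obtain ⟨L, hLt, hLv⟩ := keyL B A G hG hint hL hl
    have h3 : A * ((n^2)⁻¹ * I) < c * (Real.exp (-(2 * n⁻¹)) * ∫ w in (-n)..n, fK w) * (n^2)⁻¹ := by
      have := mul_lt_mul_of_pos_right hn1 (inv_pos.2 hl)
      linarith
    have h4 := (hLt.eventually_lt_const h3).and (eventually_gt_atTop n⁻¹)
    have h5 := (tendsto_atTop_add_const_right atTop n⁻¹ tendsto_id).eventually h4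
    filter_upwards [h5] with u hu
    have h6 := upper B hB hm hint hl hd hu.2 (hLv (u + n⁻¹))
    rw [hld, add_sub_cancel_right] at h6
    have h7 := h6.trans_lt hu.1
    have h8 : 0 < Real.exp (-(2 * n⁻¹)) * ((n^2)⁻¹ * ∫ w in (-n)..n, fK w) := by positivity
    by_contra hcon
    simp only [id] at *
    push Not at hcon
    have h9 := mul_le_mul_of_nonneg_right hcon h8.le
    nlinarith
  obtain ⟨u0, hu0⟩ := eventually_atTop.1 (hup (A+1) (by linarith))
  obtain ⟨M, hM⟩ : ∃ M, ∀ u, 0 ≤ u → B u ≤ M := by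
    refine ⟨max (A+1) (B (max u0 0) * Real.exp (max u0 0)), fun u hu => ?_⟩
    by_cases h : max u0 0 ≤ u
    · exact (hu0 u ((le_max_left _ _).trans h)).le.trans (le_max_left _ _)
    · push Not at h
      refine ((hm u _ h.le).trans ?_).trans (le_max_right _ _)
      gcongr
      · exact hB _
      · linarith
  have hlo : ∀ c, c < A → ∀ᶠ u in atTop, c < B u := by
    intro c hc
    have hexp2 : Tendsto (fun n : ℝ => Real.exp (2 * n⁻¹)) atTop (𝓝 1) := by
      have : Continuous fun x : ℝ => Real.exp (2 * x) := by fun_prop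
      have h := (this.tendsto 0).comp (tendsto_inv_atTop_zero (𝕜 := ℝ))
      simpa [Function.comp_def] using h
    have h1 : Tendsto (fun n : ℝ => M * (I - ∫ w in (-n)..n, fK w) + c * Real.exp (2 * n⁻¹) * ∫ w in (-n)..n, fK w) atTop (𝓝 (M * (I - I) + c * 1 * I)) :=
      ((tendsto_const_nhds.sub T_tendsto).const_mul M).add ((hexp2.const_mul c).mul T_tendsto)
    have h2 : M * (I - I) + c * 1 * I < A * I := by nlinarith
    obtain ⟨n, hn1, hn2, hn0⟩ := ((h1.eventually_lt_const h2).and (hTpos.and (eventually_gt_atTop 0))).exists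
    have hl : 0 < n^2 := by positivity
    have hd : 0 < n⁻¹ := by positivity
    have hld : n^2 * n⁻¹ = n := by field_simp
    obtain ⟨L, hLt, hLv⟩ := keyL B A G hG hint hL hl
    have h3 : (n^2)⁻¹ * (M * (I - ∫ w in (-n)..n, fK w) + c * Real.exp (2 * n⁻¹) * ∫ w in (-n)..n, fK w) < A * ((n^2)⁻¹ * I) := by
      have := mul_lt_mul_of_pos_left hn1 (inv_pos.2 hl)
      linarith
    have h4 := (hLt.eventually_const_lt h3)
    have h5 := (tendsto_atTop_add_const_right atTop (-n⁻¹) tendsto_id).eventually h4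
    filter_upwards [h5] with u hu
    have h6 := lower B hB hm hint hM hl hd (hLv (u + -n⁻¹))
    rw [hld, neg_add_cancel_right] at h6
    have h7 := lt_of_mul_lt_mul_left (hu.trans_le h6) (inv_pos.2 hl).le
    have h8 : 0 < Real.exp (2 * n⁻¹) * (∫ w in (-n)..n, fK w) := by positivity
    by_contra hcon
    simp only [id] at *
    push Not at hcon
    have h9 := mul_le_mul_of_nonneg_right hcon h8.le
    nlinarith
  exact tendsto_order.2 ⟨hlo, hup⟩

lemma sum_bound (a : ℕ → ℝ) (ha : ∀ n, 0 ≤ a n) (f : ℂ → ℂ)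
    (hf : ∀ z : ℂ, 1 < z.re → HasSum (fun n : ℕ => (a n : ℂ) / (n : ℂ) ^ z) (f z)) (r : ℝ) (hr : 1 < r) :
    ∃ C : ℝ, 0 ≤ C ∧ ∀ x : ℝ, 0 ≤ x → ∑ n ∈ Finset.Icc 1 ⌊x⌋₊, a n ≤ C * x ^ r := by
  have h1 : Summable (fun n : ℕ => a n / (n:ℝ)^r) := by
    have := (hf r (by simpa using hr)).summable
    rw [← Complex.summable_ofReal]
    refine this.congr fun n => ?_
    rw [Complex.ofReal_div, Complex.ofReal_cpow (Nat.cast_nonneg n)]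
    simp
  have h0 : ∀ n : ℕ, 0 ≤ a n / (n:ℝ)^r := fun n => div_nonneg (ha n) (by positivity)
  refine ⟨∑' n : ℕ, a n / (n:ℝ)^r, tsum_nonneg h0, fun x hx => ?_⟩
  calc ∑ n ∈ Finset.Icc 1 ⌊x⌋₊, a n ≤ ∑ n ∈ Finset.Icc 1 ⌊x⌋₊, a n / (n:ℝ)^r * x ^ r := by
        refine Finset.sum_le_sum fun n hn => ?_
        rw [Finset.mem_Icc] at hn
        have hn0 : (0:ℝ) < n := by exact_mod_cast hn.1
        have hnx : (n:ℝ) ≤ x := (Nat.le_floor_iff hx).1 hn.2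
        have : (n:ℝ)^r ≤ x^r := Real.rpow_le_rpow hn0.le hnx (by linarith)
        have hp : (0:ℝ) < (n:ℝ)^r := by positivity
        rw [div_mul_eq_mul_div, le_div_iff₀ hp]
        exact mul_le_mul_of_nonneg_left this (ha n)
    _ = (∑ n ∈ Finset.Icc 1 ⌊x⌋₊, a n / (n:ℝ)^r) * x ^ r := by rw [Finset.sum_mul]
    _ ≤ _ := by
        gcongr
        exact h1.sum_le_tsum _ (fun n _ => h0 n)

lemma laplace (a : ℕ → ℝ) (ha : ∀ n, 0 ≤ a n) (f : ℂ → ℂ)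
    (hf : ∀ z : ℂ, 1 < z.re → HasSum (fun n : ℕ => (a n : ℂ) / (n : ℂ) ^ z) (f z)) (z : ℂ) (hz : 1 < z.re) :
    f z = z * ∫ u in Set.Ioi (0:ℝ), ((∑ n ∈ Finset.Icc 1 ⌊Real.exp u⌋₊, a n : ℝ) : ℂ) * Complex.exp (-(z * u)) := by
  obtain ⟨r, hr1, hr2⟩ := exists_between hz
  obtain ⟨C, hC, hb⟩ := sum_bound a ha f hf r hr1
  have h1 : f z = LSeries (fun n => (a n : ℂ)) z := by
    rw [LSeries, ← (hf z hz).tsum_eq]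
    congr 1
    ext n
    rw [LSeries.term_def]
    split_ifs with hn
    · subst hn
      have : z ≠ 0 := by rintro rfl; simp at hz; linarith
      simp [Complex.zero_cpow this]
    · rfl
  rw [h1, LSeries_eq_mul_integral_of_nonneg a (by linarith) hr2 _ ha]
  · congr 1
    have him : Real.exp '' Set.Ioi 0 = Set.Ioi 1 := by
      ext x
      constructor
      · rintro ⟨u, hu, rfl⟩
        exact Real.one_lt_exp_iff.2 hu
      · intro hx
        have hx : 1 < x := hx
        exact ⟨Real.log x, Real.log_pos hx, Real.exp_log (by linarith)⟩
    rw [← him, integral_image_eq_integral_abs_deriv_smul measurableSet_Ioi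
      (fun u _ => (Real.hasDerivAt_exp u).hasDerivWithinAt) (Real.exp_injective.injOn)]
    congr 1
    ext u
    rw [abs_of_pos (Real.exp_pos u), Complex.ofReal_exp, Complex.real_smul, Complex.ofReal_exp,
      Complex.cpow_def_of_ne_zero (Complex.exp_ne_zero _), ← Complex.ofReal_exp, ← Complex.ofReal_log (Real.exp_pos u).le,
      Real.log_exp, Complex.ofReal_exp, mul_left_comm, ← Complex.exp_add]
    push_cast
    ring_nf
  · refine Asymptotics.IsBigO.of_bound C ?_
    filter_upwards with n
    have := hb n (Nat.cast_nonneg n)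
    rw [Nat.floor_natCast] at this
    rw [Real.norm_of_nonneg (Finset.sum_nonneg fun n _ => ha n), Real.norm_of_nonneg (by positivity)]
    exact this

/-- Ikehara's Tauberian theorem: if the Dirichlet series `f(z) = ∑ aₙ / n^z` with
nonnegative coefficients converges for `Re z > 1`, and `g(z) = f(z) - A/(z-1)` extends
continuously to the closed half-plane `{Re z ≥ 1}`, then `s_N / N → A`. -/
theorem ikehara_tauberian
    (a : ℕ → ℝ) (ha : ∀ n, 0 ≤ a n)
    (f : ℂ → ℂ)
    (hf : ∀ z : ℂ, 1 < z.re → HasSum (fun n : ℕ => (a n : ℂ) / (n : ℂ) ^ z) (f z))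
    (A : ℝ) (g : ℂ → ℂ)
    (hg : ContinuousOn g {z : ℂ | 1 ≤ z.re})
    (hfg : ∀ z : ℂ, 1 < z.re → g z = f z - (A : ℂ) / (z - 1)) :
    Tendsto (fun N : ℕ => (∑ n ∈ Finset.Icc 1 N, a n) / (N : ℝ)) atTop (nhds A) := by
  set S : ℝ → ℝ := fun u => ∑ n ∈ Finset.Icc 1 ⌊Real.exp u⌋₊, a n with hS
  have hS0 : ∀ u, 0 ≤ S u := fun u => Finset.sum_nonneg fun n _ => ha n
  have hSm : Monotone S := by
    intro u w huw
    refine Finset.sum_le_sum_of_subset_of_nonneg ?_ (fun n _ _ => ha n)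
    exact Finset.Icc_subset_Icc_right (Nat.floor_mono (Real.exp_le_exp.2 huw))
  set B : ℝ → ℝ := fun u => S u * Real.exp (-u) with hBdef
  have hB0 : ∀ u, 0 ≤ B u := fun u => mul_nonneg (hS0 u) (Real.exp_pos _).le
  have hint : ∀ ε : ℝ, 0 < ε → IntegrableOn (fun u => B u * Real.exp (-(ε * u))) (Set.Ioi 0) := by
    intro ε hε
    obtain ⟨C, hC, hb⟩ := sum_bound a ha f hf (1 + ε/2) (by linarith)
    have he : IntegrableOn (fun u => Real.exp (-((ε/2) * u))) (Set.Ioi 0) := by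
      simpa using exp_neg_integrableOn_Ioi 0 (half_pos hε)
    refine (he.const_mul C).mono' ?_ ?_
    · apply Measurable.aestronglyMeasurable
      have := hSm.measurable
      fun_prop
    · filter_upwards with u
      rw [Real.norm_of_nonneg (mul_nonneg (hB0 u) (Real.exp_pos _).le)]
      have h1 := hb (Real.exp u) (Real.exp_pos u).le
      rw [← Real.exp_mul] at h1
      calc B u * Real.exp (-(ε * u)) ≤ C * Real.exp (u * (1 + ε/2)) * Real.exp (-u) * Real.exp (-(ε * u)) := by
            simp only [hBdef]
            gcongr
        _ = _ := by
            rw [mul_assoc, mul_assoc, ← Real.exp_add, ← Real.exp_add]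
            ring_nf
  have hcore : Tendsto B atTop (𝓝 A) := by
    refine core B hB0 ?_ A (fun ε t => (g (1 + ε + Complex.I * t) - A) / (1 + ε + Complex.I * t)) ?_ hint ?_
    · intro u w huw
      simp only [hBdef]
      rw [mul_assoc, ← Real.exp_add]
      have : -w + (w - u) = -u := by ring
      rw [this]
      exact mul_le_mul_of_nonneg_right (hSm huw) (Real.exp_pos _).le
    · have hmaps : ∀ p : ℝ × ℝ, p ∈ Set.Ici (0:ℝ) ×ˢ (Set.univ : Set ℝ) → 1 ≤ (1 + (p.1:ℂ) + Complex.I * p.2).re := by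
        intro p hp
        have : (0:ℝ) ≤ p.1 := hp.1
        simpa using this
      have hc : ContinuousOn (fun p : ℝ × ℝ => 1 + (p.1:ℂ) + Complex.I * p.2) (Set.Ici (0:ℝ) ×ˢ (Set.univ : Set ℝ)) := by
        fun_prop
      refine ContinuousOn.div ((hg.comp hc hmaps).sub continuousOn_const) hc ?_
      intro p hp h0
      have := hmaps p hp
      rw [h0] at this
      simp at this
      linarith
    · intro ε hε t
      have hre : 1 < (1 + (ε:ℂ) + Complex.I * t).re := by simpa using hε
      set z : ℂ := 1 + (ε:ℂ) + Complex.I * t with hz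
      have hz0 : z ≠ 0 := by intro h; rw [h] at hre; simp at hre; linarith
      have hz1 : z - 1 ≠ 0 := by
        intro h
        have : (z - 1).re = 0 := by rw [h]; simp
        simp at this; linarith
      have h1 := laplace a ha f hf z hre
      have hneg : (-(z - 1)).re < 0 := by simp; linarith
      have h2 := integral_exp_mul_complex_Ioi hneg 0
      have h3 := integrableOn_exp_mul_complex_Ioi hneg 0
      have h4 : ∀ u : ℝ, (((B u - A) * Real.exp (-(ε * u)) : ℝ) : ℂ) * Complex.exp (-(Complex.I * t * u)) =
          (S u : ℂ) * Complex.exp (-(z * u)) - A * Complex.exp (-(z - 1) * u) := by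
        intro u
        have e1 : Complex.exp (-(z * u)) = Complex.exp (-u) * Complex.exp (-(ε * u)) * Complex.exp (-(Complex.I * t * u)) := by
          rw [← Complex.exp_add, ← Complex.exp_add, hz]; ring_nf
        have e2 : Complex.exp (-(z - 1) * u) = Complex.exp (-(ε * u)) * Complex.exp (-(Complex.I * t * u)) := by
          rw [← Complex.exp_add, hz]; ring_nf
        rw [e1, e2]
        simp only [hBdef]
        push_cast
        ring
      have h5 : IntegrableOn (fun u : ℝ => (S u : ℂ) * Complex.exp (-(z * u))) (Set.Ioi 0) := by
        have := (hint ε hε).ofReal (𝕜 := ℂ)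
        refine (this.mul_bdd (c := 1) (g := fun u : ℝ => Complex.exp (-(Complex.I * t * u))) ?_ ?_).congr ?_
        · apply Continuous.aestronglyMeasurable; fun_prop
        · filter_upwards with u
          have : -(Complex.I * t * u) = ((-(t * u) : ℝ) : ℂ) * Complex.I := by push_cast; ring
          rw [this, Complex.norm_exp_ofReal_mul_I]
        · filter_upwards with u
          have e1 : Complex.exp (-(z * u)) = Complex.exp (-u) * Complex.exp (-(ε * u)) * Complex.exp (-(Complex.I * t * u)) := by
            rw [← Complex.exp_add, ← Complex.exp_add, hz]; ring_nf
          rw [e1]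
          simp [hBdef]
          ring
      simp_rw [h4]
      rw [integral_sub h5 (h3.const_mul _), integral_const_mul, h2, hfg z hre, h1]
      simp only [hS]
      simp only [Complex.ofReal_zero, mul_zero, Complex.exp_zero]
      field_simp
      ring
  have hlog : Tendsto (fun N : ℕ => Real.log N) atTop atTop := Real.tendsto_log_atTop.comp tendsto_natCast_atTop_atTop
  refine (hcore.comp hlog).congr' ?_
  filter_upwards [eventually_gt_atTop 0] with N hN
  have hN' : (0:ℝ) < N := by exact_mod_cast hN
  simp only [hBdef, hS, Function.comp]
  rw [Real.exp_neg, Real.exp_log hN', Nat.floor_natCast, div_eq_mul_inv]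
end

section
/- Proposition (upper bound under the real condition): Let ∑_{n=1}^∞ a_n/n^z with a_n ≥ 0 converge to f(z) for Re z > 1. If there are constants C > 0 and x_0 ∈ (1,2) such that f(x) ≤ C/(x − 1) for all real x with 1 < x < x_0, then the partial sums s_N = ∑_{n ≤ N} a_n satisfy s_N = O(N log N) as N → ∞; that is, there exist C' > 0 and N_0 such that s_N ≤ C' · N · log N for all N ≥ N_0. -/
open Filter Finset

/-- Upper bound under the real condition: if the Dirichlet series with nonnegative
coefficients converges for `Re z > 1` and `f(x) ≤ C/(x-1)` for real `x` near `1⁺`,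
then the partial sums satisfy `s_N = O(N log N)`. -/
theorem partial_sums_bigO_N_logN_of_real_condition
    (a : ℕ → ℝ) (ha : ∀ n, 0 ≤ a n)
    (f : ℂ → ℂ)
    (hf : ∀ z : ℂ, 1 < z.re → HasSum (fun n : ℕ => (a n : ℂ) / (n : ℂ) ^ z) (f z))
    (C : ℝ) (hC : 0 < C) (x₀ : ℝ) (hx₀ : x₀ ∈ Set.Ioo (1 : ℝ) 2)
    (hreal : ∀ x : ℝ, 1 < x → x < x₀ → ‖f (x : ℂ)‖ ≤ C / (x - 1)) :
    ∃ C' : ℝ, 0 < C' ∧ ∃ N₀ : ℕ, ∀ N : ℕ, N₀ ≤ N →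
      (∑ n ∈ Finset.Icc 1 N, a n) ≤ C' * N * Real.log N := by
  obtain ⟨h1, h2⟩ := hx₀
  refine ⟨C * Real.exp 1, by positivity, ⌈Real.exp (1 / (x₀ - 1))⌉₊ + 1, fun N hN => ?_⟩
  have hpos : 0 < 1 / (x₀ - 1) := by
    apply one_div_pos.mpr
    linarith
  have hNexp : Real.exp (1 / (x₀ - 1)) < N := by
    have h3 := Nat.le_ceil (Real.exp (1 / (x₀ - 1)))
    have h4 : ((⌈Real.exp (1 / (x₀ - 1))⌉₊ + 1 : ℕ) : ℝ) ≤ N := by exact_mod_cast hN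
    push_cast at h4
    linarith
  have hN0 : (0 : ℝ) < N := lt_trans (Real.exp_pos _) hNexp
  have hlog : 1 / (x₀ - 1) < Real.log N := (Real.lt_log_iff_exp_lt hN0).2 hNexp
  have hL : 0 < Real.log N := hpos.trans hlog
  obtain ⟨x, hx⟩ : ∃ x : ℝ, x = 1 + 1 / Real.log N := ⟨_, rfl⟩
  have hx1 : 1 < x := by
    have : 0 < 1 / Real.log N := by positivity
    linarith
  have hx2 : x < x₀ := by
    have : 1 / Real.log N < x₀ - 1 := by
      rw [one_div_lt hL (by linarith)]
      exact hlog
    linarith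
  have hb := hreal x hx1 hx2
  have hCx : C / (x - 1) = C * Real.log N := by
    rw [hx]
    simp
  rw [hCx] at hb
  have hs := Complex.reCLM.hasSum (hf (x : ℂ) (by simpa using hx1))
  have hs' : HasSum (fun n : ℕ => a n / (n : ℝ) ^ x) (f x).re := by
    rw [← Complex.reCLM_apply]
    convert hs using 1
    funext n
    have : (a n : ℂ) / (n : ℂ) ^ (x : ℂ) = ((a n / (n : ℝ) ^ x : ℝ) : ℂ) := by
      rw [Complex.ofReal_div, Complex.ofReal_cpow (Nat.cast_nonneg n)]
      simp
    simp only [this, Complex.reCLM_apply, Complex.ofReal_re]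
  have hfin : ∑ n ∈ Finset.Icc 1 N, a n / (n : ℝ) ^ x ≤ C * Real.log N :=
    (sum_le_hasSum _ (fun n _ => div_nonneg (ha n) (by positivity)) hs').trans
      ((Complex.re_le_norm _).trans hb)
  have hNx : (N : ℝ) ^ x = N * Real.exp 1 := by
    rw [hx, Real.rpow_add hN0, Real.rpow_one, Real.rpow_def_of_pos hN0]
    congr 2
    field_simp
  calc (∑ n ∈ Finset.Icc 1 N, a n)
      ≤ ∑ n ∈ Finset.Icc 1 N, (N : ℝ) ^ x * (a n / (n : ℝ) ^ x) := by
        apply Finset.sum_le_sum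
        intro n hn
        obtain ⟨hn1, hn2⟩ := Finset.mem_Icc.1 hn
        have hn0 : (0 : ℝ) < n := by exact_mod_cast hn1
        have hp : 0 < (n : ℝ) ^ x := Real.rpow_pos_of_pos hn0 x
        have hle : (n : ℝ) ^ x ≤ (N : ℝ) ^ x :=
          Real.rpow_le_rpow hn0.le (by exact_mod_cast hn2) (by linarith)
        rw [mul_div_assoc', le_div_iff₀ hp, mul_comm]
        exact mul_le_mul_of_nonneg_right hle (ha n)
    _ = (N : ℝ) ^ x * ∑ n ∈ Finset.Icc 1 N, a n / (n : ℝ) ^ x := by rw [Finset.mul_sum]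
    _ ≤ (N : ℝ) ^ x * (C * Real.log N) := mul_le_mul_of_nonneg_left hfin (by positivity)
    _ = C * Real.exp 1 * N * Real.log N := by
        rw [hNx]
        ring
end

section
/- Key step in the proof of the upper bound: Let ∑_{n=1}^∞ a_n/n^x with a_n ≥ 0 converge to f(x) for real x > 1. Then for every integer N ≥ 2, the logarithmic partial sum σ_N = ∑_{n ≤ N} a_n / n satisfies σ_N ≤ e · f(1 + 1/log N). Consequently, if f(x) = O(1/(x−1)) as x ↘ 1, then σ_N = O(log N) as N → ∞. -/
open Filter Finset

/-- Key step: `σ_N = ∑_{n ≤ N} aₙ/n ≤ e · f(1 + 1/log N)` for `N ≥ 2`; consequently,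
if `f(x) = O(1/(x-1))` as `x ↘ 1`, then `σ_N = O(log N)`. -/
theorem log_partial_sums_bound
    (a : ℕ → ℝ) (ha : ∀ n, 0 ≤ a n)
    (f : ℝ → ℝ)
    (hf : ∀ x : ℝ, 1 < x → HasSum (fun n : ℕ => a n / (n : ℝ) ^ x) (f x)) :
    (∀ N : ℕ, 2 ≤ N →
      (∑ n ∈ Finset.Icc 1 N, a n / n) ≤ Real.exp 1 * f (1 + 1 / Real.log N)) ∧
    ((∃ C : ℝ, 0 < C ∧ ∃ δ : ℝ, 0 < δ ∧ ∀ x : ℝ, 1 < x → x < 1 + δ →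
        f x ≤ C / (x - 1)) →
      ∃ C' : ℝ, 0 < C' ∧ ∃ N₀ : ℕ, ∀ N : ℕ, N₀ ≤ N →
        (∑ n ∈ Finset.Icc 1 N, a n / n) ≤ C' * Real.log N) := by
  have key : ∀ N : ℕ, 2 ≤ N →
      (∑ n ∈ Finset.Icc 1 N, a n / n) ≤ Real.exp 1 * f (1 + 1 / Real.log N) := by
    intro N hN
    have hN' : (1 : ℝ) < N := by exact_mod_cast hN
    have hL : 0 < Real.log N := Real.log_pos hN'
    have hs := hf (1 + 1 / Real.log N) (by have := one_div_pos.mpr hL; linarith)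
    have h1 := sum_le_hasSum (Finset.Icc 1 N)
      (fun n _ => div_nonneg (ha n) (Real.rpow_nonneg (Nat.cast_nonneg n) _)) hs
    refine le_trans ?_ (mul_le_mul_of_nonneg_left h1 (Real.exp_pos 1).le)
    rw [Finset.mul_sum]
    apply Finset.sum_le_sum
    intro n hn
    rw [Finset.mem_Icc] at hn
    have hn0 : (0 : ℝ) < n := by exact_mod_cast hn.1
    have hnN : (n : ℝ) ≤ N := by exact_mod_cast hn.2
    have hp : 0 < (n : ℝ) ^ (1 / Real.log N) := Real.rpow_pos_of_pos hn0 _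
    have hle : (n : ℝ) ^ (1 / Real.log N) ≤ Real.exp 1 := by
      rw [Real.rpow_def_of_pos hn0]
      apply Real.exp_le_exp.mpr
      rw [mul_one_div, div_le_one hL]
      exact Real.log_le_log hn0 hnN
    rw [Real.rpow_add hn0, Real.rpow_one, ← mul_div_assoc, div_le_div_iff₀ hn0 (by positivity)]
    have h2 := mul_le_mul_of_nonneg_left hle (mul_nonneg (ha n) hn0.le)
    nlinarith [h2]
  refine ⟨key, ?_⟩
  rintro ⟨C, hC, δ, hδ, h⟩
  have ht : Tendsto (fun N : ℕ => Real.log N) atTop atTop :=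
    Real.tendsto_log_atTop.comp tendsto_natCast_atTop_atTop
  obtain ⟨M, hM⟩ := eventually_atTop.mp (ht.eventually_gt_atTop (1 / δ))
  refine ⟨Real.exp 1 * C, by positivity, max M 2, fun N hN => ?_⟩
  have hL := hM N (le_trans (le_max_left _ _) hN)
  have hL0 : 0 < Real.log N := lt_trans (by positivity) hL
  have hlt : 1 / Real.log N < δ := (one_div_lt hL0 hδ).mpr hL
  have hb := h (1 + 1 / Real.log N) (by have := one_div_pos.mpr hL0; linarith) (by linarith)
  have he : C / (1 + 1 / Real.log N - 1) = C * Real.log N := by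
    rw [add_sub_cancel_left, div_div_eq_mul_div, div_one]
  rw [he] at hb
  calc _ ≤ _ := key N (le_trans (le_max_right _ _) hN)
    _ ≤ Real.exp 1 * (C * Real.log N) := mul_le_mul_of_nonneg_left hb (Real.exp_pos 1).le
    _ = _ := by ring
end

section
/- Growth bound in the counterexample: Define a_n = 2^{2^k + k} if n = 2^{2^k} for some integer k ≥ 1, and a_n = 0 otherwise. Then the Dirichlet series f(x) = ∑_{n=1}^∞ a_n/n^x converges for all real x > 1 and satisfies f(x) = O(1/(x − 1)) as x ↘ 1; that is, there exist constants C > 0 and δ_0 ∈ (0,1) such that f(1 + δ) ≤ C/δ for all δ ∈ (0, δ_0). -/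
open Filter Finset

lemma aux_partial (q : ℝ) (h0 : 0 ≤ q) (h1 : q < 1) (K : ℕ) :
    ∑ k ∈ Finset.range K, (2:ℝ) ^ (k+1) * q ^ (2 ^ (k+1)) ≤
      2 * ∑ j ∈ Finset.range (2 ^ K + 1), q ^ j := by
  induction K with
  | zero =>
    simp only [Finset.range_zero, Finset.sum_empty]
    positivity
  | succ K ih =>
    rw [Finset.sum_range_succ]
    have e : 2 ^ (K+1) + 1 = (2 ^ K + 1) + 2 ^ K := by ring
    rw [e, Finset.sum_range_add, mul_add]
    have h : (2:ℝ) ^ K * q ^ (2 ^ (K+1)) ≤ ∑ x ∈ Finset.range (2 ^ K), q ^ (2 ^ K + 1 + x) := by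
      have := Finset.card_nsmul_le_sum (Finset.range (2 ^ K))
        (fun x => q ^ (2 ^ K + 1 + x)) (q ^ (2 ^ (K+1))) (by
          intro x hx
          apply pow_le_pow_of_le_one h0 h1.le
          have := Finset.mem_range.1 hx
          rw [pow_succ]; omega)
      simpa using this
    have e2 : (2:ℝ) ^ (K+1) * q ^ (2 ^ (K+1)) = 2 * ((2:ℝ) ^ K * q ^ (2 ^ (K+1))) := by
      rw [pow_succ (2:ℝ) K]; ring
    rw [e2]
    linarith

lemma aux_bound (q : ℝ) (h0 : 0 ≤ q) (h1 : q < 1) (K : ℕ) :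
    ∑ k ∈ Finset.range K, (2:ℝ) ^ (k+1) * q ^ (2 ^ (k+1)) ≤ 2 * (1 - q)⁻¹ := by
  refine (aux_partial q h0 h1 K).trans ?_
  have := (summable_geometric_of_lt_one h0 h1).sum_le_tsum (Finset.range (2 ^ K + 1))
    (fun i _ => pow_nonneg h0 i)
  rw [tsum_geometric_of_lt_one h0 h1] at this
  linarith

lemma aux_term (δ : ℝ) (k : ℕ) :
    (2:ℝ) ^ (2 ^ k + k) / (((2 ^ (2 ^ k) : ℕ)) : ℝ) ^ (1 + δ) =
      2 ^ k * ((1/2 : ℝ) ^ δ) ^ (2 ^ k) := by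
  have hp : (0:ℝ) < 2 ^ (2 ^ k) := by positivity
  have e : ((1/2 : ℝ) ^ δ) ^ (2 ^ k) = (((2:ℝ) ^ (2 ^ k)) ^ δ)⁻¹ := by
    rw [one_div, Real.inv_rpow (by norm_num), inv_pow, Real.rpow_pow_comm (by norm_num)]
  rw [e]
  push_cast
  rw [Real.rpow_add hp, Real.rpow_one, pow_add]
  have : (0:ℝ) < ((2:ℝ) ^ (2 ^ k)) ^ δ := Real.rpow_pos_of_pos hp δ
  field_simp

/-- Growth bound in the counterexample: with `aₙ = 2^(2^k + k)` for `n = 2^(2^k)` (`k ≥ 1`)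
and `aₙ = 0` otherwise, the Dirichlet series converges for real `x > 1` and
`f(1 + δ) ≤ C/δ` for small `δ > 0`. -/
theorem counterexample_growth_bound
    (a : ℕ → ℝ)
    (ha : ∀ k : ℕ, 1 ≤ k → a (2 ^ (2 ^ k)) = 2 ^ (2 ^ k + k))
    (ha0 : ∀ n : ℕ, (∀ k : ℕ, 1 ≤ k → n ≠ 2 ^ (2 ^ k)) → a n = 0) :
    (∀ x : ℝ, 1 < x → Summable (fun n : ℕ => a n / (n : ℝ) ^ x)) ∧
    ∃ C : ℝ, 0 < C ∧ ∃ δ₀ : ℝ, δ₀ ∈ Set.Ioo (0 : ℝ) 1 ∧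
      ∀ δ : ℝ, δ ∈ Set.Ioo (0 : ℝ) δ₀ →
        (∑' n : ℕ, a n / (n : ℝ) ^ (1 + δ)) ≤ C / δ := by
  let g : ℕ → ℕ := fun k => 2 ^ (2 ^ (k+1))
  have hg : Function.Injective g := by
    intro i j h
    have h1 := Nat.pow_right_injective (le_refl 2) h
    have h2 := Nat.pow_right_injective (le_refl 2) h1
    simpa using h2
  have hz : ∀ x : ℝ, ∀ n ∉ Set.range g, a n / (n : ℝ) ^ x = 0 := by
    intro x n hn
    rw [ha0 n, zero_div]
    rintro k hk rfl
    exact hn ⟨k - 1, by simp only [g]; rw [Nat.sub_add_cancel hk]⟩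
  have ht : ∀ δ : ℝ, ∀ k, a (g k) / ((g k : ℕ) : ℝ) ^ (1 + δ) =
      2 ^ (k+1) * ((1/2 : ℝ) ^ δ) ^ (2 ^ (k+1)) := by
    intro δ k
    rw [← aux_term, ha (k+1) (by omega)]
  refine ⟨?_, 4, by norm_num, 1/2, by norm_num, ?_⟩
  · intro x hx
    obtain ⟨δ, rfl⟩ : ∃ δ, x = 1 + δ := ⟨x - 1, by ring⟩
    have hδ : 0 < δ := by linarith
    rw [← hg.summable_iff (hz (1 + δ))]
    have h0 : (0:ℝ) ≤ (1/2 : ℝ) ^ δ := by positivity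
    have h1 : (1/2 : ℝ) ^ δ < 1 := Real.rpow_lt_one (by norm_num) (by norm_num) hδ
    have : ((fun n : ℕ => a n / (n : ℝ) ^ (1 + δ)) ∘ g) =
      fun k => (2:ℝ) ^ (k+1) * ((1/2 : ℝ) ^ δ) ^ (2 ^ (k+1)) := funext (ht δ)
    rw [this]
    exact summable_of_sum_range_le (fun k => by positivity) (aux_bound _ h0 h1)
  · rintro δ ⟨hδ, hδ'⟩
    have h0 : (0:ℝ) ≤ (1/2 : ℝ) ^ δ := by positivity
    have h1 : (1/2 : ℝ) ^ δ < 1 := Real.rpow_lt_one (by norm_num) (by norm_num) hδ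
    have hs : Function.support (fun n : ℕ => a n / (n : ℝ) ^ (1 + δ)) ⊆ Set.range g := by
      intro n hn
      by_contra h
      exact hn (hz _ n h)
    rw [← hg.tsum_eq hs]
    simp only [ht]
    refine (Real.tsum_le_of_sum_range_le (fun k => by positivity) (aux_bound _ h0 h1)).trans ?_
    have hb := rpow_one_add_le_one_add_mul_self (s := -1/2) (p := δ) (by norm_num)
      hδ.le (by linarith)
    norm_num at hb
    have h2 : δ / 2 ≤ 1 - (1/2 : ℝ) ^ δ := by norm_num; linarith
    have h3 := inv_anti₀ (by positivity) h2
    calc 2 * (1 - (1/2 : ℝ) ^ δ)⁻¹ ≤ 2 * (δ / 2)⁻¹ := by linarith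
      _ = 4 / δ := by field_simp; norm_num
end

section
/- Theorem 1.3, necessity: Let ∑_{n=1}^∞ a_n/n^z with a_n ≥ 0 converge for all z with Re z > 1, with sum f(z), and suppose the partial sums satisfy s_N = ∑_{n ≤ N} a_n ≤ M·N for all N and some constant M. Set q(x + iy) = f(x + iy)/(x + iy) for x > 1 and S(t) = e^{−t} s(e^t) for t ≥ 0, S(t) = 0 for t < 0 (so S is bounded, |S| ≤ M). Then q(x + i·) converges to the distributional Fourier transform of S as x ↘ 1, in the following sense: for every Schwartz function φ on ℝ, lim_{x ↘ 1} ∫_ℝ q(x + iy) φ(y) dy = ∫_ℝ S(t) φ̂(t) dt, where φ̂(t) = ∫_ℝ φ(y) e^{−iyt} dy. -/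
open Filter Finset
open MeasureTheory

open MeasureTheory in
lemma npl_repr
    (a : ℕ → ℝ) (ha : ∀ n, 0 ≤ a n)
    (f : ℂ → ℂ)
    (hf : ∀ z : ℂ, 1 < z.re → HasSum (fun n : ℕ => (a n : ℂ) / (n : ℂ) ^ z) (f z))
    (M : ℝ)
    (hM : ∀ N : ℕ, 1 ≤ N → (∑ n ∈ Finset.Icc 1 N, a n) ≤ M * N)
    (S : ℝ → ℝ)
    (hS : ∀ t : ℝ, 0 ≤ t →
      S t = Real.exp (-t) * ∑ n ∈ Finset.Icc 1 ⌊Real.exp t⌋₊, a n)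
    (hS0 : ∀ t : ℝ, t < 0 → S t = 0) (x y : ℝ) (hx : 1 < x) :
    f ((x : ℂ) + (y : ℂ) * Complex.I) / ((x : ℂ) + (y : ℂ) * Complex.I) =
      ∫ t : ℝ, ((S t * Real.exp (-(x - 1) * t) : ℝ) : ℂ) *
        Complex.exp (-(Complex.I * (y : ℂ) * (t : ℂ))) := by
  set z : ℂ := (x : ℂ) + (y : ℂ) * Complex.I with hz
  have hzre : z.re = x := by simp [hz]
  have hz0 : z ≠ 0 := by
    intro h; rw [h] at hzre; simp at hzre; linarith
  have hL : f z = LSeries (fun n => (a n : ℂ)) z := by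
    rw [← (hf z (by rw [hzre]; exact hx)).tsum_eq, LSeries]
    congr 1
    ext n
    rw [LSeries.term_def]
    split_ifs with h
    · subst h; simp [Complex.zero_cpow hz0]
    · rfl
  have hO : (fun n : ℕ ↦ ∑ k ∈ Icc 1 n, a k) =O[atTop] fun n : ℕ ↦ (n : ℝ) ^ (1 : ℝ) := by
    apply Asymptotics.IsBigO.of_bound M
    filter_upwards [eventually_ge_atTop 1] with n hn
    rw [Real.rpow_one, Real.norm_of_nonneg (Finset.sum_nonneg fun i _ => ha i),
      Real.norm_of_nonneg (Nat.cast_nonneg n)]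
    exact hM n hn
  rw [hL, LSeries_eq_mul_integral_of_nonneg a zero_le_one (by rw [hzre]; exact hx) hO ha,
    mul_div_cancel_left₀ _ hz0]
  have := integral_comp_exp_Ioi
    (fun t : ℝ => (∑ k ∈ Icc 1 ⌊t⌋₊, (a k : ℂ)) * (t : ℂ) ^ (-(z + 1))) 0
  rw [Real.exp_zero] at this
  rw [← this, ← integral_indicator measurableSet_Ioi]
  apply integral_congr_ae
  have h0 : ∀ᵐ t : ℝ, t ≠ 0 := by simp [ae_iff]
  filter_upwards [h0] with t ht
  rcases lt_or_gt_of_ne ht with h | h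
  · rw [Set.indicator_of_notMem (by simpa using h.le), hS0 t h]; simp
  · rw [Set.indicator_of_mem (by simpa using h), hS t h.le]
    have he : (Real.exp t : ℂ) ≠ 0 := by exact_mod_cast (Real.exp_pos t).ne'
    rw [Complex.cpow_def_of_ne_zero he, ← Complex.ofReal_log (Real.exp_pos t).le, Real.log_exp,
      Complex.real_smul]
    push_cast
    have e1 : Complex.exp (t * -(z + 1)) = Complex.exp (-t) * Complex.exp (-t)
        * Complex.exp (-(x - 1) * t) * Complex.exp (-(Complex.I * y * t)) := by
      rw [← Complex.exp_add, ← Complex.exp_add, ← Complex.exp_add]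
      congr 1
      rw [hz]; ring
    have e2 : Complex.exp t * Complex.exp (-t) = 1 := by
      rw [← Complex.exp_add]; simp
    rw [e1]
    linear_combination ((∑ k ∈ Icc 1 ⌊Real.exp t⌋₊, (a k : ℂ)) * Complex.exp (-t)
        * Complex.exp (-(x - 1) * t) * Complex.exp (-(Complex.I * y * t))) * e2

open MeasureTheory FourierTransform in
lemma npl_fourier (φ : SchwartzMap ℝ ℂ) :
    Integrable (fun t : ℝ => ∫ y : ℝ, φ y * Complex.exp (-(Complex.I * (y : ℂ) * (t : ℂ)))) := by
  have h : Integrable (fun t : ℝ => (𝓕 φ : SchwartzMap ℝ ℂ) t) := (𝓕 φ).integrable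
  have h2 := h.comp_mul_right' (R := (2 * Real.pi)⁻¹) (by positivity)
  refine h2.congr (Eventually.of_forall fun t => ?_)
  simp only [SchwartzMap.fourier_coe, Real.fourier_real_eq_integral_exp_smul]
  congr 1
  ext y
  rw [smul_eq_mul, mul_comm]
  congr 2
  push_cast
  have : (Real.pi : ℂ) ≠ 0 := by exact_mod_cast Real.pi_ne_zero
  field_simp

/-- Theorem 1.3, necessity: if `s_N ≤ M·N`, then `q(x+iy) = f(x+iy)/(x+iy)` converges,
as `x ↘ 1`, to the distributional Fourier transform of the bounded function
`S(t) = e^{-t} s(e^t)` (with `S(t) = 0` for `t < 0`); i.e., tested against any Schwartz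
function `φ`, `∫ q(x+iy) φ(y) dy → ∫ S(t) φ̂(t) dt` where `φ̂(t) = ∫ φ(y) e^{-iyt} dy`. -/
theorem necessity_pseudomeasure_limit
    (a : ℕ → ℝ) (ha : ∀ n, 0 ≤ a n)
    (f : ℂ → ℂ)
    (hf : ∀ z : ℂ, 1 < z.re → HasSum (fun n : ℕ => (a n : ℂ) / (n : ℂ) ^ z) (f z))
    (M : ℝ)
    (hM : ∀ N : ℕ, 1 ≤ N → (∑ n ∈ Finset.Icc 1 N, a n) ≤ M * N)
    (S : ℝ → ℝ)
    (hS : ∀ t : ℝ, 0 ≤ t →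
      S t = Real.exp (-t) * ∑ n ∈ Finset.Icc 1 ⌊Real.exp t⌋₊, a n)
    (hS0 : ∀ t : ℝ, t < 0 → S t = 0) :
    ∀ φ : SchwartzMap ℝ ℂ,
      Tendsto
        (fun x : ℝ =>
          ∫ y : ℝ, f ((x : ℂ) + (y : ℂ) * Complex.I) /
            ((x : ℂ) + (y : ℂ) * Complex.I) * φ y)
        (nhdsWithin 1 (Set.Ioi 1))
        (nhds (∫ t : ℝ, (S t : ℂ) *
          ∫ y : ℝ, φ y * Complex.exp (-(Complex.I * (y : ℂ) * (t : ℂ))))) := by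
  intro φ
  have hM0 : 0 ≤ M := by
    have := hM 1 le_rfl
    simp at this
    exact (ha 1).trans this
  have hSb : ∀ t, ‖S t‖ ≤ M := by
    intro t
    rcases lt_or_ge t 0 with h | h
    · rw [hS0 t h]; simpa using hM0
    · rw [hS t h, Real.norm_of_nonneg
        (mul_nonneg (Real.exp_pos _).le (Finset.sum_nonneg fun i _ => ha i))]
      have h1 : 1 ≤ ⌊Real.exp t⌋₊ := by
        rw [Nat.one_le_floor_iff]; exact Real.one_le_exp h
      have h2 : (⌊Real.exp t⌋₊ : ℝ) ≤ Real.exp t := Nat.floor_le (Real.exp_pos t).le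
      calc Real.exp (-t) * ∑ n ∈ Finset.Icc 1 ⌊Real.exp t⌋₊, a n
          ≤ Real.exp (-t) * (M * Real.exp t) := by
            gcongr
            exact (hM _ h1).trans (by gcongr)
        _ = M * (Real.exp (-t) * Real.exp t) := by ring
        _ = M := by rw [← Real.exp_add]; simp
  have hSm : Measurable S := by
    have : S = fun t => if t < 0 then 0 else
        Real.exp (-t) * (fun N : ℕ => ∑ n ∈ Finset.Icc 1 N, a n) ⌊Real.exp t⌋₊ := by
      ext t
      split_ifs with h
      · exact hS0 t h
      · exact hS t (not_lt.mp h)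
    rw [this]
    refine Measurable.ite measurableSet_Iio measurable_const ?_
    refine Measurable.mul (by fun_prop) ?_
    exact (measurable_from_nat (f := fun N : ℕ => ∑ n ∈ Finset.Icc 1 N, a n)).comp
      (Nat.measurable_floor.comp Real.measurable_exp)
  set Φ : ℝ → ℂ := fun t => ∫ y : ℝ, φ y * Complex.exp (-(Complex.I * (y : ℂ) * (t : ℂ))) with hΦ
  have hΦi : Integrable Φ := npl_fourier φ
  have key : ∀ x : ℝ, 1 < x → (∫ y : ℝ, f ((x : ℂ) + (y : ℂ) * Complex.I) /
      ((x : ℂ) + (y : ℂ) * Complex.I) * φ y) =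
      ∫ t : ℝ, ((S t * Real.exp (-(x - 1) * t) : ℝ) : ℂ) * Φ t := by
    intro x hx
    have hg : Integrable (fun t : ℝ => S t * Real.exp (-(x - 1) * t)) := by
      have hsupp : Function.support (fun t : ℝ => S t * Real.exp (-(x - 1) * t)) ⊆ Set.Ici 0 := by
        intro t ht
        by_contra h
        exact ht (by simp [hS0 t (by simpa using h)])
      rw [← integrableOn_iff_integrable_of_support_subset hsupp, integrableOn_Ici_iff_integrableOn_Ioi]
      have he := (exp_neg_integrableOn_Ioi 0 (sub_pos.mpr hx)).const_mul M
      refine he.mono' (by fun_prop) (Eventually.of_forall fun t => ?_)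
      rw [norm_mul, Real.norm_of_nonneg (Real.exp_pos _).le]
      gcongr
      exact hSb t
    have hprod : Integrable (fun p : ℝ × ℝ => (((S p.2 * Real.exp (-(x - 1) * p.2) : ℝ) : ℂ) *
        Complex.exp (-(Complex.I * (p.1 : ℂ) * (p.2 : ℂ)))) * φ p.1) (volume.prod volume) := by
      have h1 := (φ.integrable (μ := volume)).mul_prod (hg.ofReal (𝕜 := ℂ))
      have h2 := h1.bdd_mul (f := fun p : ℝ × ℝ =>
        Complex.exp (-(Complex.I * (p.1 : ℂ) * (p.2 : ℂ)))) (c := 1)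
        (by apply Continuous.aestronglyMeasurable; fun_prop)
        (Eventually.of_forall fun p => by rw [Complex.norm_exp]; simp)
      refine h2.congr (Eventually.of_forall fun p => ?_)
      simp only [RCLike.ofReal_eq_complex_ofReal]
      ring
    calc _ = ∫ y : ℝ, ∫ t : ℝ, ((S t * Real.exp (-(x - 1) * t) : ℝ) : ℂ) *
        Complex.exp (-(Complex.I * (y : ℂ) * (t : ℂ))) * φ y := by
          congr 1
          ext y
          rw [npl_repr a ha f hf M hM S hS hS0 x y hx, integral_mul_const]
      _ = ∫ t : ℝ, ∫ y : ℝ, ((S t * Real.exp (-(x - 1) * t) : ℝ) : ℂ) *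
        Complex.exp (-(Complex.I * (y : ℂ) * (t : ℂ))) * φ y := integral_integral_swap hprod
      _ = _ := by
          congr 1
          ext t
          rw [hΦ, ← integral_const_mul]
          congr 1
          ext y
          ring
  have hlim : Tendsto (fun x : ℝ => ∫ t : ℝ, ((S t * Real.exp (-(x - 1) * t) : ℝ) : ℂ) * Φ t)
      (nhdsWithin 1 (Set.Ioi 1)) (nhds (∫ t : ℝ, (S t : ℂ) * Φ t)) := by
    refine tendsto_integral_filter_of_dominated_convergence (fun t => M * ‖Φ t‖) ?_ ?_ ?_ ?_
    · refine Eventually.of_forall fun x => AEStronglyMeasurable.mul ?_ hΦi.aestronglyMeasurable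
      apply Measurable.aestronglyMeasurable
      fun_prop
    · filter_upwards [self_mem_nhdsWithin] with x hx
      refine Eventually.of_forall fun t => ?_
      rw [norm_mul, Complex.norm_real]
      gcongr
      rcases lt_or_ge t 0 with h | h
      · rw [hS0 t h]; simpa using hM0
      · rw [norm_mul, Real.norm_of_nonneg (Real.exp_pos _).le]
        have h1 : Real.exp (-(x - 1) * t) ≤ 1 := by
          rw [Real.exp_le_one_iff]
          have : 0 ≤ (x - 1) * t := mul_nonneg (sub_nonneg.mpr (le_of_lt hx)) h
          linarith
        calc _ ≤ M * 1 := mul_le_mul (hSb t) h1 (Real.exp_pos _).le hM0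
          _ = M := mul_one M
    · exact hΦi.norm.const_mul M
    · refine Eventually.of_forall fun t => ?_
      have : Continuous (fun x : ℝ => ((S t * Real.exp (-(x - 1) * t) : ℝ) : ℂ) * Φ t) := by
        fun_prop
      have h := this.tendsto 1
      simp only [sub_self, neg_zero, zero_mul, Real.exp_zero, mul_one] at h
      exact h.mono_left nhdsWithin_le_nhds
  refine hlim.congr' ?_
  filter_upwards [self_mem_nhdsWithin] with x hx
  exact (key x hx).symm
end

section
/- Theorem 1.3, sufficiency: Let ∑_{n=1}^∞ a_n/n^z with a_n ≥ 0 converge for all z with Re z > 1, with sum f(z), and set q(x + iy) = f(x + iy)/(x + iy) for x > 1. Suppose there exists a bounded measurable function H: ℝ → ℂ such that for every Schwartz function φ on ℝ, lim_{x ↘ 1} ∫_ℝ q(x + iy) φ(y) dy = ∫_ℝ H(t) φ̂(t) dt, where φ̂(t) = ∫_ℝ φ(y) e^{−iyt} dy (i.e., q(x + i·) converges in the sense of tempered distributions to a pseudomeasure as x ↘ 1). Then the sequence s_N/N, with s_N = ∑_{n ≤ N} a_n, is bounded. -/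
open Filter Finset

lemma suff_aux_swap (φ : SchwartzMap ℝ ℂ) (x l : ℝ) (hx : 0 < x) :
    ∫ y : ℝ, Complex.exp (-((x : ℂ) + (y : ℂ) * Complex.I) * l) /
        ((x : ℂ) + (y : ℂ) * Complex.I) * φ y =
    ∫ v in Set.Ioi l, Complex.exp (-((x : ℂ) * v)) *
      ∫ y : ℝ, φ y * Complex.exp (-(Complex.I * (y : ℂ) * (v : ℂ))) := by
  have h1 : ∀ y : ℝ, Complex.exp (-((x : ℂ) + (y : ℂ) * Complex.I) * l) /
        ((x : ℂ) + (y : ℂ) * Complex.I) * φ y =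
        ∫ v in Set.Ioi l, Complex.exp (-((x : ℂ) + (y : ℂ) * Complex.I) * v) * φ y := by
    intro y
    rw [MeasureTheory.integral_mul_const, integral_exp_mul_complex_Ioi (by simpa using hx)]
    rw [neg_div_neg_eq]
  simp_rw [h1]
  rw [MeasureTheory.integral_integral_swap]
  · congr 1
    ext v
    rw [← MeasureTheory.integral_const_mul]
    congr 1
    ext y
    rw [mul_left_comm, ← Complex.exp_add, mul_comm]
    congr 2
    ring
  · have hb : MeasureTheory.Integrable (fun p : ℝ × ℝ => (φ p.1) * (Real.exp (-x * p.2) : ℂ))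
        (MeasureTheory.volume.prod (MeasureTheory.volume.restrict (Set.Ioi l))) := by
      apply MeasureTheory.Integrable.mul_prod (f := fun y => φ y)
        (g := fun v : ℝ => (Real.exp (-x * v) : ℂ))
      · exact φ.integrable
      · exact (integrableOn_exp_mul_Ioi (by linarith) l).ofReal
    refine hb.mono ?_ ?_
    · apply Continuous.aestronglyMeasurable
      have := φ.continuous
      simp only [Function.uncurry_def]
      fun_prop
    · refine Eventually.of_forall fun p => ?_
      simp [Function.uncurry, Complex.norm_exp, mul_comm]

/-- the test function -/
lemma suff_aux_test (τ : ℝ) : ∃ (φ : SchwartzMap ℝ ℂ) (g : ℝ → ℝ), Continuous g ∧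
    (∀ t, 0 ≤ g t) ∧ (∀ t, g t ≤ 1) ∧ (∀ t, t ∈ Set.Icc τ (τ + 1) → g t = 1) ∧
    (∀ t, t ∉ Set.Icc (τ - 20) (τ + 20) → g t = 0) ∧
    ∀ t : ℝ, ∫ y : ℝ, φ y * Complex.exp (-(Complex.I * (y : ℂ) * (t : ℂ))) = (g t : ℂ) := by
  have hpi := Real.pi_gt_three
  have hpi4 := Real.pi_lt_d2
  let b : ContDiffBump (τ / (2 * Real.pi)) := ⟨1, 2, one_pos, one_lt_two⟩
  have hs : HasCompactSupport (fun w : ℝ => (b w : ℂ)) :=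
    b.hasCompactSupport.comp_left (g := fun r : ℝ => (r : ℂ)) (by simp)
  have hd : ContDiff ℝ (⊤ : ℕ∞) (fun w : ℝ => (b w : ℂ)) :=
    Complex.ofRealCLM.contDiff.comp b.contDiff
  let G : SchwartzMap ℝ ℂ := hs.toSchwartzMap hd
  have hG : ∀ w, G w = (b w : ℂ) := fun w => rfl
  have key : ∀ t : ℝ, |t / (2 * Real.pi) - τ / (2 * Real.pi)| = |t - τ| / (2 * Real.pi) := by
    intro t
    rw [← sub_div, abs_div, abs_of_pos (a := 2 * Real.pi) (by positivity)]
  refine ⟨FourierTransformInv.fourierInv G, fun t => b (t / (2 * Real.pi)),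
    b.continuous.comp (by fun_prop), fun t => b.nonneg, fun t => b.le_one, ?_, ?_, ?_⟩
  · intro t ht
    apply b.one_of_mem_closedBall
    rw [Metric.mem_closedBall, Real.dist_eq, key, div_le_iff₀ (by positivity)]
    change _ ≤ 1 * _
    rw [abs_le]; constructor <;> linarith [ht.1, ht.2]
  · intro t ht
    apply b.zero_of_le_dist
    rw [Real.dist_eq, key, le_div_iff₀ (by positivity)]
    change 2 * _ ≤ _
    by_contra hc
    push Not at hc
    rw [abs_lt] at hc
    exact ht ⟨by linarith [hc.1], by linarith [hc.2]⟩
  · intro t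
    rw [← hG]
    have : G = FourierTransform.fourier (FourierTransformInv.fourierInv G) := by simp
    conv_rhs => rw [this]
    rw [SchwartzMap.fourier_coe, Real.fourier_real_eq_integral_exp_smul]
    congr 1
    ext y
    rw [smul_eq_mul, mul_comm]
    congr 2
    have : (Real.pi : ℂ) ≠ 0 := by exact_mod_cast Real.pi_ne_zero
    push_cast
    field_simp

theorem sufficiency_boundedness
    (a : ℕ → ℝ) (ha : ∀ n, 0 ≤ a n)
    (f : ℂ → ℂ)
    (hf : ∀ z : ℂ, 1 < z.re → HasSum (fun n : ℕ => (a n : ℂ) / (n : ℂ) ^ z) (f z))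
    (H : ℝ → ℂ) (hHmeas : Measurable H)
    (hHbdd : ∃ M : ℝ, ∀ t : ℝ, ‖H t‖ ≤ M)
    (hconv : ∀ φ : SchwartzMap ℝ ℂ,
      Tendsto
        (fun x : ℝ =>
          ∫ y : ℝ, f ((x : ℂ) + (y : ℂ) * Complex.I) /
            ((x : ℂ) + (y : ℂ) * Complex.I) * φ y)
        (nhdsWithin 1 (Set.Ioi 1))
        (nhds (∫ t : ℝ, H t *
          ∫ y : ℝ, φ y * Complex.exp (-(Complex.I * (y : ℂ) * (t : ℂ)))))) :
    ∃ C : ℝ, ∀ N : ℕ, (∑ n ∈ Finset.Icc 1 N, a n) ≤ C * N := by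
  obtain ⟨M, hM⟩ := hHbdd
  have hM0 : 0 ≤ M := (norm_nonneg _).trans (hM 0)
  refine ⟨40 * M * Real.exp 1, fun N => ?_⟩
  rcases Nat.eq_zero_or_pos N with rfl | hN
  · simp
  have hNr : (0 : ℝ) < N := by exact_mod_cast hN
  set τ := Real.log N with hτ
  obtain ⟨φ, g, gc, g0, g1, gone, gz, hφ⟩ := suff_aux_test τ
  have hlim := hconv φ
  simp_rw [hφ] at hlim
  -- bound on the limit
  have hL : ‖∫ t : ℝ, H t * (g t : ℂ)‖ ≤ 40 * M := by
    have e : ∫ t : ℝ, H t * (g t : ℂ) = ∫ t in Set.Icc (τ - 20) (τ + 20), H t * (g t : ℂ) := by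
      rw [MeasureTheory.setIntegral_eq_integral_of_forall_compl_eq_zero]
      intro t ht
      simp [gz t ht]
    rw [e]
    refine (MeasureTheory.norm_setIntegral_le_of_norm_le_const (C := M) (by simp) ?_).trans ?_
    · intro t _
      rw [norm_mul, Complex.norm_real, Real.norm_of_nonneg (g0 t)]
      calc _ ≤ M * 1 := mul_le_mul (hM t) (g1 t) (g0 t) hM0
        _ = M := mul_one M
    · rw [Real.volume_real_Icc_of_le (by linarith)]
      linarith
  -- lower bound
  have hlow : ∀ x : ℝ, 1 < x → (∑ n ∈ Finset.Icc 1 N, a n) * Real.exp (-(x * (τ + 1))) ≤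
      ‖∫ y : ℝ, f ((x : ℂ) + (y : ℂ) * Complex.I) /
            ((x : ℂ) + (y : ℂ) * Complex.I) * φ y‖ := by
    intro x hx
    have hx0 : 0 < x := by linarith
    have hz : ∀ y : ℝ, ((x : ℂ) + (y : ℂ) * Complex.I) ≠ 0 := by
      intro y h
      have := congrArg Complex.re h
      simp at this
      linarith
    let I : ℝ → ℝ := fun l => ∫ v in Set.Ioi l, Real.exp (-(x * v)) * g v
    have hexpint : ∀ l, MeasureTheory.IntegrableOn (fun v => Real.exp (-(x * v)) * g v)
        (Set.Ioi l) := by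
      intro l
      refine MeasureTheory.Integrable.mono (integrableOn_exp_mul_Ioi (a := -x) (by linarith) l)
        (Continuous.aestronglyMeasurable (by fun_prop)) (Eventually.of_forall fun v => ?_)
      rw [norm_mul, Real.norm_of_nonneg (g0 v), neg_mul]
      exact mul_le_of_le_one_right (norm_nonneg _) (g1 v)
    have hI0 : ∀ l, 0 ≤ I l := fun l =>
      MeasureTheory.setIntegral_nonneg measurableSet_Ioi
        fun v _ => mul_nonneg (Real.exp_nonneg _) (g0 v)
    have hIlow : ∀ l, l ≤ τ → Real.exp (-(x * (τ + 1))) ≤ I l := by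
      intro l hl
      have h1 : ∫ v in Set.Ioc τ (τ + 1), Real.exp (-(x * v)) * g v ≤ I l := by
        apply MeasureTheory.setIntegral_mono_set (hexpint l)
        · exact Eventually.of_forall fun v => mul_nonneg (Real.exp_nonneg _) (g0 v)
        · exact HasSubset.Subset.eventuallyLE fun v hv => lt_of_le_of_lt hl hv.1
      refine le_trans ?_ h1
      have h2 : ∫ v in Set.Ioc τ (τ + 1), Real.exp (-(x * (τ + 1))) ≤
          ∫ v in Set.Ioc τ (τ + 1), Real.exp (-(x * v)) * g v := by
        apply MeasureTheory.setIntegral_mono_on (by simp)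
          ((hexpint τ).mono_set fun v hv => hv.1) measurableSet_Ioc
        intro v hv
        rw [gone v ⟨hv.1.le, hv.2⟩, mul_one]
        apply Real.exp_le_exp.2
        nlinarith [hv.2]
      refine le_trans (le_of_eq ?_) h2
      simp
    -- sum
    have hre : ∀ y : ℝ, ((x : ℂ) + (y : ℂ) * Complex.I).re = x := by intro y; simp
    let F : ℕ → ℝ → ℂ := fun n y => (a n : ℂ) / (n : ℂ) ^ ((x : ℂ) + (y : ℂ) * Complex.I) /
            ((x : ℂ) + (y : ℂ) * Complex.I) * φ y
    have hF0 : ∀ y, F 0 y = 0 := by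
      intro y
      simp [F, Complex.zero_cpow (hz y)]
    have hFn : ∀ n : ℕ, 0 < n → ∀ y, F n y = (a n : ℂ) *
        (Complex.exp (-((x : ℂ) + (y : ℂ) * Complex.I) * (Real.log n : ℝ)) /
        ((x : ℂ) + (y : ℂ) * Complex.I) * φ y) := by
      intro n hn y
      simp only [F]
      rw [Complex.cpow_def_of_ne_zero (by exact_mod_cast hn.ne'), Complex.ofReal_log (by positivity),
        neg_mul, Complex.exp_neg, mul_comm (Complex.log _)]
      push_cast
      field_simp
    have hFint : ∀ n : ℕ, 0 < n → ∫ y, F n y = ((a n * I (Real.log n) : ℝ) : ℂ) := by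
      intro n hn
      simp_rw [hFn n hn]
      rw [MeasureTheory.integral_const_mul, suff_aux_swap φ x _ hx0]
      simp_rw [hφ]
      simp only [I]
      rw [Complex.ofReal_mul, ← integral_complex_ofReal]
      push_cast
      rfl
    have hFnorm : ∀ n y, ‖F n y‖ ≤ (a n / (n : ℝ) ^ x) * ‖φ y‖ := by
      intro n y
      rcases Nat.eq_zero_or_pos n with rfl | hn
      · rw [hF0]; simp [Real.zero_rpow hx0.ne']
      · simp only [F]
        rw [norm_mul, norm_div, norm_div, Complex.norm_natCast_cpow_of_pos hn, hre,
          Complex.norm_real, Real.norm_of_nonneg (ha n)]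
        refine mul_le_mul_of_nonneg_right (div_le_self (div_nonneg (ha n) (by positivity)) ?_)
          (norm_nonneg _)
        have := Complex.abs_re_le_norm ((x : ℂ) + (y : ℂ) * Complex.I)
        rw [hre, abs_of_pos hx0] at this
        linarith
    have hFI : ∀ n, MeasureTheory.Integrable (F n) := by
      intro n
      refine (φ.integrable.norm.const_mul (a n / (n : ℝ) ^ x)).mono' ?_
        (Eventually.of_forall (hFnorm n))
      rcases Nat.eq_zero_or_pos n with rfl | hn
      · rw [show F 0 = fun _ => 0 from funext hF0]
        exact MeasureTheory.aestronglyMeasurable_const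
      · rw [show F n = _ from funext (hFn n hn)]
        apply Continuous.aestronglyMeasurable
        have := φ.continuous
        refine continuous_const.mul (Continuous.mul (Continuous.div ?_ ?_ hz) this) <;> fun_prop
    have hsum : Summable fun n : ℕ => a n / (n : ℝ) ^ x := by
      have := (hf (x : ℂ) (by simpa using hx)).summable.norm
      refine this.congr fun n => ?_
      rw [norm_div, Complex.norm_real, Real.norm_of_nonneg (ha n)]
      congr 1
      rw [← Complex.ofReal_natCast, ← Complex.ofReal_cpow (by positivity), Complex.norm_real,
        Real.norm_of_nonneg (by positivity)]
    have hS := MeasureTheory.hasSum_integral_of_summable_integral_norm hFI (by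
      refine Summable.of_nonneg_of_le (fun n => MeasureTheory.integral_nonneg fun y => norm_nonneg _)
        (fun n => ?_) (hsum.mul_right (∫ y, ‖φ y‖))
      rw [← MeasureTheory.integral_const_mul]
      exact MeasureTheory.integral_mono (hFI n).norm (φ.integrable.norm.const_mul _) (hFnorm n))
    have hts : ∀ y, ∑' n, F n y = f ((x : ℂ) + (y : ℂ) * Complex.I) /
            ((x : ℂ) + (y : ℂ) * Complex.I) * φ y := fun y =>
      (((hf _ (by rw [hre]; exact hx)).div_const _).mul_right _).tsum_eq
    simp_rw [hts] at hS
    have hSre := Complex.hasSum_re hS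
    refine le_trans ?_ ((le_abs_self _).trans (Complex.abs_re_le_norm _))
    refine le_trans ?_ (sum_le_hasSum (Finset.Icc 1 N) ?_ hSre)
    · rw [Finset.sum_mul]
      refine Finset.sum_le_sum fun n hn => ?_
      rw [Finset.mem_Icc] at hn
      rw [hFint n hn.1, Complex.ofReal_re]
      refine mul_le_mul_of_nonneg_left (hIlow _ ?_) (ha n)
      exact Real.log_le_log (by exact_mod_cast hn.1) (by exact_mod_cast hn.2)
    · intro n _
      rcases Nat.eq_zero_or_pos n with rfl | hn
      · simp [hF0]
      · rw [hFint n hn, Complex.ofReal_re]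
        exact mul_nonneg (ha n) (hI0 _)
  have hlim2 : Tendsto (fun x : ℝ => (∑ n ∈ Finset.Icc 1 N, a n) * Real.exp (-(x * (τ + 1))))
      (nhdsWithin 1 (Set.Ioi 1)) (nhds ((∑ n ∈ Finset.Icc 1 N, a n) * Real.exp (-(1 * (τ + 1))))) :=
    (Continuous.tendsto (by fun_prop) 1).mono_left nhdsWithin_le_nhds
  have hfin := (le_of_tendsto_of_tendsto hlim2 hlim.norm
    (eventually_nhdsWithin_of_forall fun x hx => hlow x hx)).trans hL
  have he : Real.exp (-(1 * (τ + 1))) * (Real.exp 1 * N) = 1 := by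
    rw [one_mul, Real.exp_neg, Real.exp_add, hτ, Real.exp_log hNr]
    field_simp
  calc _ = ((∑ n ∈ Finset.Icc 1 N, a n) * Real.exp (-(1 * (τ + 1)))) * (Real.exp 1 * N) := by
        rw [mul_assoc, he, mul_one]
    _ ≤ 40 * M * (Real.exp 1 * N) := by gcongr
    _ = _ := by ring
end

section
/- Two-way Ikehara-type theorem with boundedness: Let ∑_{n=1}^∞ a_n/n^z with a_n ≥ 0 converge for all z with Re z > 1, with sum f(z), and set q(x + iy) = f(x + iy)/(x + iy) for x > 1 and s_N = ∑_{n ≤ N} a_n. Then the sequence s_N/N is bounded if and only if there exists a bounded measurable function H: ℝ → ℂ such that for every Schwartz function φ on ℝ, lim_{x ↘ 1} ∫_ℝ q(x + iy) φ(y) dy = ∫_ℝ H(t) φ̂(t) dt, where φ̂(t) = ∫_ℝ φ(y) e^{−iyt} dy; that is, if and only if q(x + i·) converges in the sense of tempered distributions to a pseudomeasure as x ↘ 1. -/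
open Filter Finset

noncomputable def ikS (a : ℕ → ℝ) (t : ℝ) : ℝ := ∑ k ∈ Finset.Icc 1 ⌊Real.exp t⌋₊, a k

lemma ikS_nonneg {a : ℕ → ℝ} (ha : ∀ n, 0 ≤ a n) (t : ℝ) : 0 ≤ ikS a t :=
  Finset.sum_nonneg fun i _ => ha i

lemma ikS_mono {a : ℕ → ℝ} (ha : ∀ n, 0 ≤ a n) : Monotone (ikS a) := by
  intro s t hst
  unfold ikS
  refine Finset.sum_le_sum_of_subset_of_nonneg ?_ (fun i _ _ => ha i)
  exact Finset.Icc_subset_Icc le_rfl (Nat.floor_mono (Real.exp_le_exp.mpr hst))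

lemma ikS_neg (a : ℕ → ℝ) {t : ℝ} (ht : t < 0) : ikS a t = 0 := by
  unfold ikS
  have : ⌊Real.exp t⌋₊ = 0 := Nat.floor_eq_zero.mpr (Real.exp_lt_one_iff.mpr ht)
  simp [this]

lemma ik_sum_bound {a : ℕ → ℝ} (ha : ∀ n, 0 ≤ a n) (f : ℂ → ℂ)
    (hf : ∀ z : ℂ, 1 < z.re → HasSum (fun n : ℕ => (a n : ℂ) / (n : ℂ) ^ z) (f z))
    {σ : ℝ} (hσ : 1 < σ) :
    ∃ B : ℝ, 0 ≤ B ∧ ∀ N : ℕ, (∑ n ∈ Finset.Icc 1 N, a n) ≤ B * (N : ℝ) ^ σ := by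
  have h1 : Summable (fun n : ℕ => a n / (n : ℝ) ^ σ) := by
    have := (hf σ (by simpa using hσ)).summable
    rw [← Complex.summable_ofReal]
    refine this.congr fun n => ?_
    rw [Complex.ofReal_div, Complex.ofReal_cpow (Nat.cast_nonneg n)]
    simp
  have hnn : ∀ n : ℕ, 0 ≤ a n / (n : ℝ) ^ σ := fun n => div_nonneg (ha n) (by positivity)
  refine ⟨∑' n : ℕ, a n / (n : ℝ) ^ σ, tsum_nonneg hnn, fun N => ?_⟩
  calc (∑ n ∈ Finset.Icc 1 N, a n) ≤ ∑ n ∈ Finset.Icc 1 N, a n / (n : ℝ) ^ σ * (N : ℝ) ^ σ := by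
        refine Finset.sum_le_sum fun n hn => ?_
        obtain ⟨h1, h2⟩ := Finset.mem_Icc.mp hn
        have hn0 : (0 : ℝ) < n := by exact_mod_cast h1
        rw [div_mul_eq_mul_div, le_div_iff₀ (by positivity)]
        refine mul_le_mul_of_nonneg_left ?_ (ha n)
        exact Real.rpow_le_rpow hn0.le (by exact_mod_cast h2) (by linarith)
    _ = (∑ n ∈ Finset.Icc 1 N, a n / (n : ℝ) ^ σ) * (N : ℝ) ^ σ := by rw [Finset.sum_mul]
    _ ≤ _ := by
        refine mul_le_mul_of_nonneg_right ?_ (by positivity)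
        exact h1.sum_le_tsum _ fun n _ => hnn n

lemma ikS_integrable {a : ℕ → ℝ} (ha : ∀ n, 0 ≤ a n) (f : ℂ → ℂ)
    (hf : ∀ z : ℂ, 1 < z.re → HasSum (fun n : ℕ => (a n : ℂ) / (n : ℂ) ^ z) (f z))
    {x : ℝ} (hx : 1 < x) :
    MeasureTheory.Integrable (fun t : ℝ => ikS a t * Real.exp (-x * t)) := by
  obtain ⟨B, hB, hb⟩ := ik_sum_bound ha f hf (σ := (1 + x) / 2) (by linarith)
  have hI : MeasureTheory.Integrable
      ((Set.Ici (0:ℝ)).indicator fun t : ℝ => B * Real.exp (-((x - 1) / 2) * t)) := by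
    rw [MeasureTheory.integrable_indicator_iff measurableSet_Ici,
      integrableOn_Ici_iff_integrableOn_Ioi]
    exact (exp_neg_integrableOn_Ioi 0 (by linarith)).const_mul B
  refine hI.mono' ?_ (Eventually.of_forall fun t => ?_)
  · exact ((ikS_mono ha).measurable.mul (by fun_prop)).aestronglyMeasurable
  · rw [Real.norm_of_nonneg (mul_nonneg (ikS_nonneg ha t) (Real.exp_pos _).le)]
    by_cases ht : t < 0
    · simp [ikS_neg a ht, ht]
    · rw [Set.indicator_of_mem (by simpa using ht)]
      have h1 : ikS a t ≤ B * Real.exp ((1 + x) / 2 * t) := by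
        refine (hb _).trans (mul_le_mul_of_nonneg_left ?_ hB)
        calc ((⌊Real.exp t⌋₊ : ℕ) : ℝ) ^ ((1 + x) / 2) ≤ (Real.exp t) ^ ((1 + x) / 2) :=
              Real.rpow_le_rpow (by positivity) (Nat.floor_le (Real.exp_pos _).le) (by linarith)
          _ = _ := by rw [← Real.exp_mul, mul_comm]
      calc _ ≤ B * Real.exp ((1 + x) / 2 * t) * Real.exp (-x * t) :=
            mul_le_mul_of_nonneg_right h1 (Real.exp_pos _).le
        _ = _ := by rw [mul_assoc, ← Real.exp_add]; congr 2; ring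

lemma ik_laplace {a : ℕ → ℝ} (ha : ∀ n, 0 ≤ a n) (f : ℂ → ℂ)
    (hf : ∀ z : ℂ, 1 < z.re → HasSum (fun n : ℕ => (a n : ℂ) / (n : ℂ) ^ z) (f z))
    {z : ℂ} (hz : 1 < z.re) :
    f z / z = ∫ t : ℝ, (ikS a t : ℂ) * Complex.exp (-z * t) := by
  have hz0 : z ≠ 0 := by rintro rfl; norm_num at hz
  obtain ⟨B, hB, hb⟩ := ik_sum_bound ha f hf (σ := (1 + z.re) / 2) (by linarith)
  have hO : (fun n ↦ ∑ k ∈ Finset.Icc 1 n, a k) =O[atTop] fun n ↦ (n : ℝ) ^ ((1 + z.re) / 2) := by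
    refine Asymptotics.isBigO_iff.mpr ⟨B, Eventually.of_forall fun N => ?_⟩
    rw [Real.norm_of_nonneg (Finset.sum_nonneg fun i _ => ha i),
      Real.norm_of_nonneg (by positivity)]
    exact hb N
  have h := LSeries_eq_mul_integral_of_nonneg a (r := (1 + z.re) / 2) (by linarith) (s := z)
    (by linarith) hO ha
  have hL : LSeries (fun n => (a n : ℂ)) z = f z := by
    rw [LSeries, ← (hf z hz).tsum_eq]
    exact tsum_congr fun n => LSeries.term_of_ne_zero' hz0 _ n
  rw [← hL, h, mul_div_cancel_left₀ _ hz0]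
  have himg : Real.exp '' Set.Ioi 0 = Set.Ioi 1 := by
    ext u
    constructor
    · rintro ⟨t, ht, rfl⟩
      exact Real.one_lt_exp_iff.mpr ht
    · intro hu
      have hu : 1 < u := hu
      exact ⟨Real.log u, Real.log_pos hu, Real.exp_log (by linarith)⟩
  rw [← himg, MeasureTheory.integral_image_eq_integral_abs_deriv_smul measurableSet_Ioi
    (fun t _ => (Real.hasDerivAt_exp t).hasDerivWithinAt) Real.exp_injective.injOn]
  have hind : (fun t : ℝ => (ikS a t : ℂ) * Complex.exp (-z * t)) =
      (Set.Ici (0:ℝ)).indicator (fun t : ℝ => (ikS a t : ℂ) * Complex.exp (-z * t)) := by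
    ext t
    by_cases ht : t < 0
    · simp [ikS_neg a ht, ht]
    · rw [Set.indicator_of_mem (by simpa using ht)]
  rw [hind, MeasureTheory.integral_indicator measurableSet_Ici,
    MeasureTheory.integral_Ici_eq_integral_Ioi]
  refine MeasureTheory.setIntegral_congr_fun measurableSet_Ioi fun t _ => ?_
  simp only [abs_of_pos (Real.exp_pos t), ikS, Complex.real_smul, Complex.ofReal_sum]
  rw [Complex.ofReal_exp, mul_left_comm]
  congr 1
  rw [Complex.cpow_def_of_ne_zero (Complex.exp_ne_zero _), ← Complex.ofReal_exp,
    ← Complex.ofReal_log (Real.exp_pos t).le, Real.log_exp, Complex.ofReal_exp, ← Complex.exp_add]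
  congr 1; ring

lemma ik_key {a : ℕ → ℝ} (ha : ∀ n, 0 ≤ a n) (f : ℂ → ℂ)
    (hf : ∀ z : ℂ, 1 < z.re → HasSum (fun n : ℕ => (a n : ℂ) / (n : ℂ) ^ z) (f z))
    {x : ℝ} (hx : 1 < x) (φ : SchwartzMap ℝ ℂ) :
    (∫ y : ℝ, f ((x : ℂ) + (y : ℂ) * Complex.I) / ((x : ℂ) + (y : ℂ) * Complex.I) * φ y) =
    ∫ t : ℝ, ((ikS a t * Real.exp (-x * t) : ℝ) : ℂ) *
      ∫ y : ℝ, φ y * Complex.exp (-(Complex.I * (y : ℂ) * (t : ℂ))) := by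
  have h1 : ∀ y : ℝ, f ((x : ℂ) + (y : ℂ) * Complex.I) / ((x : ℂ) + (y : ℂ) * Complex.I) * φ y
      = ∫ t : ℝ, ((ikS a t * Real.exp (-x * t) : ℝ) : ℂ) *
        (φ y * Complex.exp (-(Complex.I * (y : ℂ) * (t : ℂ)))) := by
    intro y
    rw [ik_laplace ha f hf (by simpa using hx), ← MeasureTheory.integral_mul_const]
    congr 1; ext t
    have : Complex.exp (-((x : ℂ) + (y : ℂ) * Complex.I) * t) = ((Real.exp (-x * t) : ℝ) : ℂ) *
        Complex.exp (-(Complex.I * (y : ℂ) * (t : ℂ))) := by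
      rw [Complex.ofReal_exp, ← Complex.exp_add]
      congr 1; push_cast; ring
    rw [this]; push_cast; ring
  simp_rw [h1]
  rw [MeasureTheory.integral_integral_swap]
  · congr 1; ext t
    rw [MeasureTheory.integral_const_mul]
  · have hp := φ.integrable (μ := MeasureTheory.volume).mul_prod
      ((ikS_integrable ha f hf hx).ofReal (𝕜 := ℂ))
    have hp2 := hp.mul_bdd (c := 1)
      (g := fun p : ℝ × ℝ => Complex.exp (-(Complex.I * (p.1 : ℂ) * (p.2 : ℂ))))
      (by fun_prop) (Eventually.of_forall fun p => by
        rw [Complex.norm_exp]; simp)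
    refine hp2.congr (Eventually.of_forall fun p => ?_)
    simp only [Function.uncurry]
    simp
    ring

lemma ik_fourier (φ : SchwartzMap ℝ ℂ) (t : ℝ) :
    (∫ y : ℝ, φ y * Complex.exp (-(Complex.I * (y : ℂ) * (t : ℂ)))) =
      (FourierTransform.fourier φ : SchwartzMap ℝ ℂ) (t / (2 * Real.pi)) := by
  rw [SchwartzMap.fourier_coe, Real.fourier_real_eq_integral_exp_smul]
  congr 1; ext y
  rw [smul_eq_mul, mul_comm]
  congr 2
  have : -2 * Real.pi * y * (t / (2 * Real.pi)) = - (y * t) := by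
    field_simp
  rw [this]; push_cast; ring
  
lemma ik_fourier_integrable (φ : SchwartzMap ℝ ℂ) :
    MeasureTheory.Integrable (fun t : ℝ =>
      ∫ y : ℝ, φ y * Complex.exp (-(Complex.I * (y : ℂ) * (t : ℂ)))) := by
  simp_rw [ik_fourier]
  exact (SchwartzMap.integrable _).comp_div (by positivity)

lemma ik_forward {a : ℕ → ℝ} (ha : ∀ n, 0 ≤ a n) (f : ℂ → ℂ)
    (hf : ∀ z : ℂ, 1 < z.re → HasSum (fun n : ℕ => (a n : ℂ) / (n : ℂ) ^ z) (f z))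
    {C : ℝ} (hC : ∀ N : ℕ, (∑ n ∈ Finset.Icc 1 N, a n) ≤ C * N) :
    ∃ H : ℝ → ℂ, Measurable H ∧ (∃ M : ℝ, ∀ t : ℝ, ‖H t‖ ≤ M) ∧
      ∀ φ : SchwartzMap ℝ ℂ,
        Tendsto
          (fun x : ℝ =>
            ∫ y : ℝ, f ((x : ℂ) + (y : ℂ) * Complex.I) /
              ((x : ℂ) + (y : ℂ) * Complex.I) * φ y)
          (nhdsWithin 1 (Set.Ioi 1))
          (nhds (∫ t : ℝ, H t *
            ∫ y : ℝ, φ y * Complex.exp (-(Complex.I * (y : ℂ) * (t : ℂ))))) := by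
  have hC0 : 0 ≤ C := by have := hC 1; simp at this; linarith [ha 1]
  have hSm := (ikS_mono ha).measurable
  have hbd : ∀ t, ikS a t ≤ C * Real.exp t := fun t =>
    (hC _).trans (mul_le_mul_of_nonneg_left (Nat.floor_le (Real.exp_pos _).le) hC0)
  have hbd' : ∀ x : ℝ, 1 ≤ x → ∀ t, ‖((ikS a t * Real.exp (-x * t) : ℝ) : ℂ)‖ ≤ C := by
    intro x hx t
    rw [Complex.norm_real, Real.norm_of_nonneg (mul_nonneg (ikS_nonneg ha t) (Real.exp_pos _).le)]
    by_cases ht : t < 0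
    · simp [ikS_neg a ht, hC0]
    · push Not at ht
      calc _ ≤ C * Real.exp t * Real.exp (-x * t) :=
            mul_le_mul_of_nonneg_right (hbd t) (Real.exp_pos _).le
        _ = C * Real.exp (-((x - 1) * t)) := by rw [mul_assoc, ← Real.exp_add]; congr 2; ring
        _ ≤ C * 1 := mul_le_mul_of_nonneg_left
            (Real.exp_le_one_iff.mpr (by have := mul_nonneg (sub_nonneg.mpr hx) ht; linarith)) hC0
        _ = C := mul_one _
  refine ⟨fun t => ((ikS a t * Real.exp (-(1:ℝ) * t) : ℝ) : ℂ), ?_, ⟨C, hbd' 1 le_rfl⟩, fun φ => ?_⟩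
  · exact Complex.measurable_ofReal.comp (hSm.mul (by fun_prop))
  have hev : ∀ᶠ x : ℝ in nhdsWithin 1 (Set.Ioi 1), 1 < x := self_mem_nhdsWithin
  have hI := ik_fourier_integrable φ
  refine Tendsto.congr' (f₁ := fun x : ℝ => ∫ t : ℝ, ((ikS a t * Real.exp (-x * t) : ℝ) : ℂ) *
      ∫ y : ℝ, φ y * Complex.exp (-(Complex.I * (y : ℂ) * (t : ℂ)))) ?_ ?_
  · filter_upwards [hev] with x hx using (ik_key ha f hf hx φ).symm
  refine MeasureTheory.tendsto_integral_filter_of_dominated_convergence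
    (fun t => C * ‖∫ y : ℝ, φ y * Complex.exp (-(Complex.I * (y : ℂ) * (t : ℂ)))‖) ?_ ?_
    (hI.norm.const_mul C) ?_
  · refine Eventually.of_forall fun x => ?_
    exact (Complex.measurable_ofReal.comp (hSm.mul (by fun_prop))).aestronglyMeasurable.mul
      hI.aestronglyMeasurable
  · filter_upwards [hev] with x hx
    refine Eventually.of_forall fun t => ?_
    rw [norm_mul]
    exact mul_le_mul_of_nonneg_right (hbd' x hx.le t) (norm_nonneg _)
  · refine Eventually.of_forall fun t => ?_
    refine Tendsto.mul_const _ ?_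
    refine Tendsto.mono_left ?_ nhdsWithin_le_nhds
    have : Continuous fun x : ℝ => ((ikS a t * Real.exp (-x * t) : ℝ) : ℂ) := by fun_prop
    exact this.tendsto 1

lemma ik_test (T : ℝ) : ∃ φ : SchwartzMap ℝ ℂ, ∃ ψ : ℝ → ℝ, Continuous ψ ∧
    (∀ t : ℝ, (∫ y : ℝ, φ y * Complex.exp (-(Complex.I * (y : ℂ) * (t : ℂ)))) = (ψ t : ℂ)) ∧
    (∀ t, 0 ≤ ψ t) ∧ (∀ t, ψ t ≤ 1) ∧ (∀ t ∈ Set.Icc T (T + 1), ψ t = 1) ∧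
    (∀ t ∉ Set.Icc (T - 1) (T + 2), ψ t = 0) := by
  have hpi := Real.pi_pos
  let b : ContDiffBump ((T + 1 / 2) / (2 * Real.pi)) :=
    ⟨(1 / 2) / (2 * Real.pi), 1 / (2 * Real.pi), by positivity, by gcongr; norm_num⟩
  have hcs : HasCompactSupport (fun t : ℝ => (b t : ℂ)) :=
    b.hasCompactSupport.comp_left (g := fun r : ℝ => (r : ℂ)) (by simp)
  have hcd : ContDiff ℝ ((⊤ : ℕ∞) : WithTop ℕ∞) (fun t : ℝ => (b t : ℂ)) :=
    Complex.ofRealCLM.contDiff.comp b.contDiff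
  let Ψ : SchwartzMap ℝ ℂ := hcs.toSchwartzMap hcd
  have hdist : ∀ t : ℝ, dist (t / (2 * Real.pi)) ((T + 1 / 2) / (2 * Real.pi)) =
      |t - (T + 1 / 2)| / (2 * Real.pi) := by
    intro t
    rw [Real.dist_eq, ← sub_div, abs_div, abs_of_pos (by positivity : 0 < 2 * Real.pi)]
  refine ⟨FourierTransformInv.fourierInv Ψ, fun t => b (t / (2 * Real.pi)), ?_, fun t => ?_, fun t => b.nonneg,
    fun t => b.le_one, fun t ht => ?_, fun t ht => ?_⟩
  · exact b.continuous.comp (by fun_prop)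
  · rw [ik_fourier, FourierTransform.fourier_fourierInv_eq]
    rfl
  · refine b.one_of_mem_closedBall ?_
    rw [Metric.mem_closedBall, hdist]
    refine div_le_div_of_nonneg_right ?_ (by positivity)
    rw [abs_le]; constructor <;> linarith [ht.1, ht.2]
  · refine b.zero_of_le_dist ?_
    rw [hdist]
    refine div_le_div_of_nonneg_right ?_ (by positivity)
    by_contra! hlt
    rw [abs_lt] at hlt
    exact ht ⟨by linarith, by linarith⟩

lemma ik_backward {a : ℕ → ℝ} (ha : ∀ n, 0 ≤ a n) (f : ℂ → ℂ)
    (hf : ∀ z : ℂ, 1 < z.re → HasSum (fun n : ℕ => (a n : ℂ) / (n : ℂ) ^ z) (f z))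
    (H : ℝ → ℂ) {M : ℝ} (hM : ∀ t : ℝ, ‖H t‖ ≤ M)
    (h : ∀ φ : SchwartzMap ℝ ℂ,
        Tendsto
          (fun x : ℝ =>
            ∫ y : ℝ, f ((x : ℂ) + (y : ℂ) * Complex.I) /
              ((x : ℂ) + (y : ℂ) * Complex.I) * φ y)
          (nhdsWithin 1 (Set.Ioi 1))
          (nhds (∫ t : ℝ, H t *
            ∫ y : ℝ, φ y * Complex.exp (-(Complex.I * (y : ℂ) * (t : ℂ)))))) (T : ℝ) (hT : 0 ≤ T) :
    ikS a T * Real.exp (-(T + 1)) ≤ 3 * M := by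
  have hM0 : 0 ≤ M := (norm_nonneg _).trans (hM 0)
  obtain ⟨φ, ψ, hc, hφ, h0, h1, hin, hout⟩ := ik_test T
  have hlim := h φ
  simp_rw [hφ] at hlim
  have hev : ∀ᶠ x : ℝ in nhdsWithin 1 (Set.Ioi 1), 1 < x := self_mem_nhdsWithin
  have hup : ‖∫ t : ℝ, H t * (ψ t : ℂ)‖ ≤ 3 * M := by
    calc ‖∫ t : ℝ, H t * (ψ t : ℂ)‖ 
        ≤ ∫ t : ℝ, (Set.Icc (T - 1) (T + 2)).indicator (fun _ => M) t := by
          refine MeasureTheory.norm_integral_le_of_norm_le ?_ (Eventually.of_forall fun t => ?_)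
          · rw [MeasureTheory.integrable_indicator_iff measurableSet_Icc]
            exact MeasureTheory.integrableOn_const (by simp)
          · by_cases ht : t ∈ Set.Icc (T - 1) (T + 2)
            · rw [Set.indicator_of_mem ht, norm_mul, Complex.norm_real, Real.norm_of_nonneg (h0 t)]
              calc _ ≤ M * 1 := mul_le_mul (hM t) (h1 t) (h0 t) hM0
                _ = M := mul_one _
            · simp [hout t ht, Set.indicator_of_notMem ht]
      _ = 3 * M := by
          rw [MeasureTheory.integral_indicator measurableSet_Icc, MeasureTheory.setIntegral_const]
          rw [Real.volume_real_Icc_of_le (by linarith), smul_eq_mul]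
          ring
  have hlow : ∀ᶠ x : ℝ in nhdsWithin 1 (Set.Ioi 1), ikS a T * Real.exp (-x * (T + 1)) ≤
      ‖∫ y : ℝ, f ((x : ℂ) + (y : ℂ) * Complex.I) /
              ((x : ℂ) + (y : ℂ) * Complex.I) * φ y‖ := by
    filter_upwards [hev] with x hx
    rw [ik_key ha f hf hx φ]
    simp_rw [hφ, ← Complex.ofReal_mul]
    rw [integral_complex_ofReal, Complex.norm_real]
    refine le_trans ?_ (le_abs_self _)
    have hint : MeasureTheory.Integrable (fun t => ikS a t * Real.exp (-x * t) * ψ t) :=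
      (ikS_integrable ha f hf hx).mul_bdd (c := 1) hc.aestronglyMeasurable
        (Eventually.of_forall fun t => by rw [Real.norm_of_nonneg (h0 t)]; exact h1 t)
    calc ikS a T * Real.exp (-x * (T + 1)) 
        = ∫ t : ℝ, (Set.Icc T (T + 1)).indicator
            (fun _ => ikS a T * Real.exp (-x * (T + 1))) t := by
          rw [MeasureTheory.integral_indicator measurableSet_Icc, MeasureTheory.setIntegral_const]
          rw [Real.volume_real_Icc_of_le (by linarith), smul_eq_mul]
          ring
      _ ≤ _ := by
          refine MeasureTheory.integral_mono ?_ hint fun t => ?_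
          · rw [MeasureTheory.integrable_indicator_iff measurableSet_Icc]
            exact MeasureTheory.integrableOn_const (by simp)
          · by_cases ht : t ∈ Set.Icc T (T + 1)
            · simp only [Set.indicator_of_mem ht, hin t ht, mul_one]
              refine mul_le_mul (ikS_mono ha ht.1) (Real.exp_le_exp.mpr ?_) (Real.exp_pos _).le
                (ikS_nonneg ha t)
              nlinarith [ht.2]
            · rw [Set.indicator_of_notMem ht]
              exact mul_nonneg (mul_nonneg (ikS_nonneg ha t) (Real.exp_pos _).le) (h0 t)
  have hl : Tendsto (fun x : ℝ => ikS a T * Real.exp (-x * (T + 1))) (nhdsWithin 1 (Set.Ioi 1))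
      (nhds (ikS a T * Real.exp (-1 * (T + 1)))) := by
    refine Tendsto.mono_left ?_ nhdsWithin_le_nhds
    have : Continuous fun x : ℝ => ikS a T * Real.exp (-x * (T + 1)) := by fun_prop
    exact this.tendsto 1
  have := le_of_tendsto_of_tendsto hl hlim.norm hlow
  rw [neg_one_mul] at this
  exact this.trans hup




/-- Two-way Ikehara-type theorem with boundedness: `s_N/N` is bounded if and only if
`q(x+iy) = f(x+iy)/(x+iy)` converges, as `x ↘ 1` and in the sense of tempered
distributions, to a pseudomeasure, i.e. the Fourier transform of some bounded
measurable function `H`. -/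
theorem two_way_ikehara_boundedness
    (a : ℕ → ℝ) (ha : ∀ n, 0 ≤ a n)
    (f : ℂ → ℂ)
    (hf : ∀ z : ℂ, 1 < z.re → HasSum (fun n : ℕ => (a n : ℂ) / (n : ℂ) ^ z) (f z)) :
    (∃ C : ℝ, ∀ N : ℕ, (∑ n ∈ Finset.Icc 1 N, a n) ≤ C * N) ↔
    (∃ H : ℝ → ℂ, Measurable H ∧ (∃ M : ℝ, ∀ t : ℝ, ‖H t‖ ≤ M) ∧
      ∀ φ : SchwartzMap ℝ ℂ,
        Tendsto
          (fun x : ℝ =>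
            ∫ y : ℝ, f ((x : ℂ) + (y : ℂ) * Complex.I) /
              ((x : ℂ) + (y : ℂ) * Complex.I) * φ y)
          (nhdsWithin 1 (Set.Ioi 1))
          (nhds (∫ t : ℝ, H t *
            ∫ y : ℝ, φ y * Complex.exp (-(Complex.I * (y : ℂ) * (t : ℂ)))))) := by
  constructor
  · rintro ⟨C, hC⟩
    exact ik_forward ha f hf hC
  · rintro ⟨H, -, ⟨M, hM⟩, h⟩
    refine ⟨3 * M * Real.exp 1, fun N => ?_⟩
    rcases Nat.eq_zero_or_pos N with rfl | hN
    · simp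
    have hN' : (1 : ℝ) ≤ N := by exact_mod_cast hN
    have h1 := ik_backward ha f hf H hM h (Real.log N) (Real.log_nonneg hN')
    have h2 : ikS a (Real.log N) = ∑ n ∈ Finset.Icc 1 N, a n := by
      rw [ikS, Real.exp_log (by linarith), Nat.floor_natCast]
    rw [h2, Real.exp_neg, ← div_eq_mul_inv, div_le_iff₀ (Real.exp_pos _), Real.exp_add,
      Real.exp_log (by linarith)] at h1
    linarith
end

section
/- Pseudomeasure criterion for the boundedness of the twin-prime counting function: Let Λ denote the von Mangoldt function, ψ₂(N) = ∑_{n ≤ N} Λ(n)Λ(n+2), and D₂(z) = ∑_{n=1}^∞ Λ(n)Λ(n+2)/n^z for Re z > 1 (the series converges there). Then ψ₂(N) = O(N) as N → ∞ if and only if there exists a bounded measurable function H: ℝ → ℂ such that for every Schwartz function φ on ℝ, lim_{x ↘ 1} ∫_ℝ (D₂(x + iy)/(x + iy)) φ(y) dy = ∫_ℝ H(t) φ̂(t) dt, where φ̂(t) = ∫_ℝ φ(y) e^{−iyt} dy; that is, if and only if D₂(x+iy)/(x+iy) converges distributionally to a pseudomeasure as x ↘ 1. -/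
open Filter Finset ArithmeticFunction

/-- twin coefficients -/
noncomputable def twA (n : ℕ) : ℝ := Λ n * Λ (n + 2)

lemma twA_nonneg (n : ℕ) : 0 ≤ twA n := mul_nonneg vonMangoldt_nonneg vonMangoldt_nonneg

/-- summatory function in exponential variable -/
noncomputable def twS (u : ℝ) : ℝ := ∑ k ∈ Finset.Icc 1 ⌊Real.exp u⌋₊, twA k

lemma twS_nonneg (u : ℝ) : 0 ≤ twS u := Finset.sum_nonneg fun _ _ => twA_nonneg _

lemma twS_mono : Monotone twS := by
  intro u v h
  refine Finset.sum_le_sum_of_subset_of_nonneg ?_ fun _ _ _ => twA_nonneg _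
  exact Finset.Icc_subset_Icc le_rfl (Nat.floor_mono (Real.exp_le_exp.mpr h))

lemma twS_zero {u : ℝ} (hu : u ≤ 0) : twS u = 0 := by
  have h : twS 0 = 0 := by simp [twS, twA]
  exact le_antisymm (h ▸ twS_mono hu) (twS_nonneg u)

lemma twA_bound {d : ℝ} (hd : 0 < d) : ∃ C : ℝ, 0 ≤ C ∧ ∀ n : ℕ, twA n ≤ C * (n : ℝ) ^ d := by
  refine ⟨(1 / (d/2)) * (3 ^ (d/2) / (d/2)), by positivity, fun n => ?_⟩
  rcases Nat.eq_zero_or_pos n with rfl | hn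
  · simp [twA, Real.zero_rpow hd.ne']
  have hn1 : (1 : ℝ) ≤ n := by exact_mod_cast hn
  have h1 : Λ n ≤ (n : ℝ) ^ (d/2) / (d/2) :=
    vonMangoldt_le_log.trans (Real.log_le_rpow_div (by positivity) (by positivity))
  have h2 : Λ (n + 2) ≤ (3 * n : ℝ) ^ (d/2) / (d/2) := by
    refine vonMangoldt_le_log.trans (le_trans ?_ (Real.log_le_rpow_div (by positivity) (by positivity)))
    apply Real.log_le_log (by positivity)
    push_cast
    linarith
  refine (mul_le_mul h1 h2 vonMangoldt_nonneg (by positivity)).trans (le_of_eq ?_)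
  rw [Real.mul_rpow (by norm_num) (by positivity)]
  have : (n : ℝ) ^ d = (n : ℝ) ^ (d/2) * (n : ℝ) ^ (d/2) := by
    rw [← Real.rpow_add (by positivity)]; congr 1; ring
  rw [this]; ring

lemma twSum_bound {r : ℝ} (hr : 1 < r) :
    ∃ C : ℝ, 0 ≤ C ∧ ∀ N : ℕ, ∑ k ∈ Finset.Icc 1 N, twA k ≤ C * (N : ℝ) ^ r := by
  obtain ⟨C, hC, h⟩ := twA_bound (d := r - 1) (by linarith)
  refine ⟨C, hC, fun N => ?_⟩
  rcases Nat.eq_zero_or_pos N with rfl | hN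
  · simp [Real.zero_rpow (by linarith : r ≠ 0)]
  have hN' : (0 : ℝ) < N := by exact_mod_cast hN
  calc ∑ k ∈ Finset.Icc 1 N, twA k ≤ ∑ k ∈ Finset.Icc 1 N, C * (N : ℝ) ^ (r - 1) := by
        refine Finset.sum_le_sum fun k hk => (h k).trans ?_
        have hk2 : (k : ℝ) ≤ N := by exact_mod_cast (Finset.mem_Icc.mp hk).2
        gcongr
    _ = C * (N : ℝ) ^ r := by
        rw [Finset.sum_const, Nat.card_Icc, nsmul_eq_mul, Nat.add_sub_cancel,
          Real.rpow_sub_one hN'.ne']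
        field_simp

lemma twS_bound {r : ℝ} (hr : 1 < r) :
    ∃ C : ℝ, 0 ≤ C ∧ ∀ u : ℝ, twS u ≤ C * Real.exp (r * u) := by
  obtain ⟨C, hC, h⟩ := twSum_bound hr
  refine ⟨C, hC, fun u => (h _).trans ?_⟩
  rw [mul_comm r u, Real.exp_mul]
  have := Nat.floor_le (Real.exp_pos u).le
  gcongr

lemma tw_isBigO {r : ℝ} (hr : 1 < r) :
    (fun n ↦ ∑ k ∈ Finset.Icc 1 n, twA k) =O[atTop] fun n : ℕ ↦ (n : ℝ) ^ r := by
  obtain ⟨C, hC, h⟩ := twSum_bound hr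
  refine Asymptotics.IsBigO.of_bound C (Eventually.of_forall fun n => ?_)
  rw [Real.norm_of_nonneg (Finset.sum_nonneg fun _ _ => twA_nonneg _),
    Real.norm_of_nonneg (by positivity)]
  exact h n

lemma tw_term {z : ℂ} (hz : 1 < z.re) :
    LSeries.term (fun n => (twA n : ℂ)) z = fun n : ℕ =>
        ((Λ n * Λ (n + 2) : ℝ) : ℂ) / (n : ℂ) ^ z := by
  have hz0 : z ≠ 0 := by rintro rfl; simp at hz; linarith
  ext n
  rw [LSeries.term_of_ne_zero' hz0]
  rfl

lemma tw_summable {z : ℂ} (hz : 1 < z.re) :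
    Summable (fun n : ℕ => ((Λ n * Λ (n + 2) : ℝ) : ℂ) / (n : ℂ) ^ z) := by
  rw [← tw_term hz]
  exact LSeriesSummable_of_sum_norm_bigO_and_nonneg (r := (1 + z.re) / 2) (tw_isBigO (by linarith))
    twA_nonneg (by linarith) (by linarith)

lemma tw_repr {z : ℂ} (hz : 1 < z.re) :
    (∑' n : ℕ, ((Λ n * Λ (n + 2) : ℝ) : ℂ) / (n : ℂ) ^ z) / z =
      ∫ u : ℝ, (twS u : ℂ) * Complex.exp (-(z * u)) := by
  have hz0 : z ≠ 0 := by rintro rfl; simp at hz; linarith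
  have h := LSeries_eq_mul_integral_of_nonneg twA (r := (1 + z.re) / 2) (s := z) (by linarith)
    (by linarith) (tw_isBigO (by linarith)) twA_nonneg
  rw [LSeries, tw_term hz] at h
  rw [h, mul_div_cancel_left₀ _ hz0]
  have him : Real.exp '' Set.Ioi 0 = Set.Ioi 1 := by
    ext t
    simp only [Set.mem_image, Set.mem_Ioi]
    constructor
    · rintro ⟨u, hu, rfl⟩
      exact Real.one_lt_exp_iff.mpr hu
    · intro ht
      exact ⟨Real.log t, Real.log_pos ht, Real.exp_log (by linarith)⟩
  rw [← him, MeasureTheory.integral_image_eq_integral_abs_deriv_smul measurableSet_Ioi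
    (fun u _ => (Real.hasDerivAt_exp u).hasDerivWithinAt) Real.exp_injective.injOn,
    ← MeasureTheory.setIntegral_eq_integral_of_forall_compl_eq_zero (s := Set.Ioi 0)
      (f := fun u : ℝ => (twS u : ℂ) * Complex.exp (-(z * u)))]
  · refine MeasureTheory.integral_congr_ae (Eventually.of_forall fun u => ?_)
    simp only [twS, abs_of_pos (Real.exp_pos u), Complex.real_smul, Complex.ofReal_sum]
    rw [Complex.cpow_def_of_ne_zero (by simp), ← Complex.ofReal_log (Real.exp_pos u).le,
      Real.log_exp, mul_left_comm, Complex.ofReal_exp, ← Complex.exp_add]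
    congr 2
    ring
  · intro u hu
    rw [twS_zero (by simpa using hu)]
    simp

lemma tw_integrable {x : ℝ} (hx : 1 < x) :
    MeasureTheory.Integrable (fun u : ℝ => twS u * Real.exp (-(x * u))) := by
  obtain ⟨C, hC, h⟩ := twS_bound (r := (1 + x) / 2) (by linarith)
  have h0 : MeasureTheory.IntegrableOn (fun u : ℝ => twS u * Real.exp (-(x * u))) (Set.Ioi 0) := by
    refine MeasureTheory.Integrable.mono'
      ((integrableOn_exp_mul_Ioi (a := -((x - 1) / 2)) (by linarith) 0).const_mul C) ?_
      (Eventually.of_forall fun u => ?_)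
    · exact (twS_mono.measurable.mul (by fun_prop)).aestronglyMeasurable
    · rw [Real.norm_of_nonneg (mul_nonneg (twS_nonneg u) (Real.exp_pos _).le)]
      refine (mul_le_mul_of_nonneg_right (h u) (Real.exp_pos _).le).trans (le_of_eq ?_)
      rw [mul_assoc, ← Real.exp_add]
      congr 2
      ring
  rw [MeasureTheory.integrableOn_iff_integrable_of_support_subset] at h0
  · exact h0
  · intro u hu
    by_contra hu'
    exact hu (by simp [twS_zero (by simpa using hu')])

lemma tw_fubini {x : ℝ} (hx : 1 < x) (φ : SchwartzMap ℝ ℂ) :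
    (∫ y : ℝ, (∑' n : ℕ, ((Λ n * Λ (n + 2) : ℝ) : ℂ) /
                    (n : ℂ) ^ ((x : ℂ) + (y : ℂ) * Complex.I)) /
                  ((x : ℂ) + (y : ℂ) * Complex.I) * φ y) =
    ∫ u : ℝ, ((twS u * Real.exp (-(x * u)) : ℝ) : ℂ) *
      ∫ y : ℝ, φ y * Complex.exp (-(Complex.I * (y : ℂ) * (u : ℂ))) := by
  have hre : ∀ y : ℝ, 1 < ((x : ℂ) + (y : ℂ) * Complex.I).re := by intro y; simpa using hx
  simp_rw [tw_repr (hre _), ← MeasureTheory.integral_mul_const, ← MeasureTheory.integral_const_mul]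
  rw [MeasureTheory.integral_integral_swap]
  · refine MeasureTheory.integral_congr_ae (Eventually.of_forall fun u => ?_)
    refine MeasureTheory.integral_congr_ae (Eventually.of_forall fun y => ?_)
    simp only
    push_cast
    have : Complex.exp (-(((x : ℂ) + y * Complex.I) * u)) =
      Complex.exp (-(x * u)) * Complex.exp (-(Complex.I * y * u)) := by
      rw [← Complex.exp_add]; congr 1; ring
    rw [this]; ring
  · have h1 := MeasureTheory.Integrable.mul_prod (φ.integrable (μ := MeasureTheory.volume))
      ((tw_integrable hx).ofReal (𝕜 := ℂ))
    have h2 := h1.bdd_mul (c := 1) (f := fun p : ℝ × ℝ => Complex.exp (-(Complex.I * p.1 * p.2)))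
      (by fun_prop) (Eventually.of_forall fun p => by simp [Complex.norm_exp])
    refine h2.congr (Eventually.of_forall fun p => ?_)
    obtain ⟨y, u⟩ := p
    simp only [Function.uncurry]
    have : Complex.exp (-(((x : ℂ) + y * Complex.I) * u)) =
      Complex.exp (-(x * u)) * Complex.exp (-(Complex.I * y * u)) := by
      rw [← Complex.exp_add]; congr 1; ring
    rw [this]
    simp
    ring

open FourierTransform in
lemma tw_hat (φ : SchwartzMap ℝ ℂ) (u : ℝ) :
    (∫ y : ℝ, φ y * Complex.exp (-(Complex.I * (y : ℂ) * (u : ℂ)))) =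
      (𝓕 φ) (u / (2 * Real.pi)) := by
  rw [SchwartzMap.fourier_coe, Real.fourier_real_eq_integral_exp_smul]
  refine MeasureTheory.integral_congr_ae (Eventually.of_forall fun y => ?_)
  simp only [smul_eq_mul]
  rw [mul_comm]
  congr 2
  have := Real.pi_ne_zero
  have : (Real.pi : ℂ) ≠ 0 := by exact_mod_cast this
  push_cast
  field_simp

open FourierTransform in
lemma tw_hat_integrable (φ : SchwartzMap ℝ ℂ) : MeasureTheory.Integrable (fun u : ℝ =>
    (∫ y : ℝ, φ y * Complex.exp (-(Complex.I * (y : ℂ) * (u : ℂ))))) := by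
  simp_rw [tw_hat]
  exact ((𝓕 φ).integrable).comp_div (by positivity)

lemma tw_forward {C : ℝ} (hC : ∀ N : ℕ, (∑ n ∈ Finset.Icc 1 N, twA n) ≤ C * N) :
    (∀ u : ℝ, ‖((twS u * Real.exp (-u) : ℝ) : ℂ)‖ ≤ C) ∧ ∀ φ : SchwartzMap ℝ ℂ,
    Tendsto (fun x : ℝ => ∫ u : ℝ, ((twS u * Real.exp (-(x * u)) : ℝ) : ℂ) *
      ∫ y : ℝ, φ y * Complex.exp (-(Complex.I * (y : ℂ) * (u : ℂ))))
      (nhdsWithin 1 (Set.Ioi 1))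
      (nhds (∫ u : ℝ, ((twS u * Real.exp (-u) : ℝ) : ℂ) *
      ∫ y : ℝ, φ y * Complex.exp (-(Complex.I * (y : ℂ) * (u : ℂ))))) := by
  have hC0 : 0 ≤ C := by
    have := hC 1
    have h2 : 0 ≤ ∑ n ∈ Finset.Icc 1 1, twA n := Finset.sum_nonneg fun _ _ => twA_nonneg _
    simp only [Nat.cast_one, mul_one] at this
    linarith
  have hb : ∀ u : ℝ, ‖((twS u * Real.exp (-u) : ℝ) : ℂ)‖ ≤ C := by
    intro u
    rw [Complex.norm_real, Real.norm_of_nonneg (mul_nonneg (twS_nonneg u) (Real.exp_pos _).le),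
      Real.exp_neg, ← div_eq_mul_inv, div_le_iff₀ (Real.exp_pos u)]
    refine (hC _).trans ?_
    exact mul_le_mul_of_nonneg_left (Nat.floor_le (Real.exp_pos u).le) hC0
  refine ⟨hb, fun φ => ?_⟩
  have hΦ := tw_hat_integrable φ
  refine MeasureTheory.tendsto_integral_filter_of_dominated_convergence
    (fun u => C * ‖∫ y : ℝ, φ y * Complex.exp (-(Complex.I * (y : ℂ) * (u : ℂ)))‖) ?_ ?_
    (hΦ.norm.const_mul C) ?_
  · refine Eventually.of_forall fun x => ?_
    refine MeasureTheory.AEStronglyMeasurable.mul ?_ hΦ.aestronglyMeasurable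
    exact (Complex.measurable_ofReal.comp
      (twS_mono.measurable.mul (by fun_prop))).aestronglyMeasurable
  · filter_upwards [self_mem_nhdsWithin] with x hx
    refine Eventually.of_forall fun u => ?_
    rw [norm_mul]
    refine mul_le_mul_of_nonneg_right (le_trans ?_ (hb u)) (norm_nonneg _)
    rw [Complex.norm_real, Complex.norm_real, norm_mul, norm_mul]
    rcases le_total u 0 with hu | hu
    · simp [twS_zero hu]
    · refine mul_le_mul_of_nonneg_left ?_ (norm_nonneg _)
      rw [Real.norm_of_nonneg (Real.exp_pos _).le, Real.norm_of_nonneg (Real.exp_pos _).le,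
        Real.exp_le_exp]
      have : 1 < x := hx
      nlinarith
  · refine Eventually.of_forall fun u => ?_
    have hc : Continuous fun x : ℝ => ((twS u * Real.exp (-(x * u)) : ℝ) : ℂ) *
      ∫ y : ℝ, φ y * Complex.exp (-(Complex.I * (y : ℂ) * (u : ℂ))) := by fun_prop
    have := hc.tendsto 1
    rw [one_mul] at this
    exact this.mono_left nhdsWithin_le_nhds

open FourierTransform in
lemma tw_test (h : ℝ) : ∃ (φ : SchwartzMap ℝ ℂ) (g : ℝ → ℝ),
    (∀ u : ℝ, (∫ y : ℝ, φ y * Complex.exp (-(Complex.I * (y : ℂ) * (u : ℂ)))) = (g u : ℂ)) ∧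
    (∀ u, 0 ≤ g u) ∧ (∀ u ∈ Set.Icc h (h + 1), g u = 1) ∧ MeasureTheory.Integrable g ∧
    ∫ u, g u ≤ 2 * Real.pi * 4 ∧ ∃ B, ∀ u, g u ≤ B := by
  let b : ContDiffBump (h / (2 * Real.pi)) := ⟨1, 2, by norm_num, by norm_num⟩
  have hcs : HasCompactSupport (fun w : ℝ => ((b w : ℝ) : ℂ)) :=
    b.hasCompactSupport.comp_left (g := fun r : ℝ => (r : ℂ)) Complex.ofReal_zero
  let ψ : SchwartzMap ℝ ℂ := hcs.toSchwartzMap (Complex.ofRealCLM.contDiff.comp b.contDiff)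
  have hpi := Real.pi_gt_three
  refine ⟨𝓕⁻ ψ, fun u => b (u / (2 * Real.pi)), fun u => ?_, fun u => b.nonneg, fun u hu => ?_,
    ?_, ?_, 1, fun u => b.le_one⟩
  · rw [tw_hat, FourierTransform.fourier_fourierInv_eq]
    rfl
  · apply b.one_of_mem_closedBall
    rw [Metric.mem_closedBall, Real.dist_eq, ← sub_div, abs_div, abs_of_pos (a := 2 * Real.pi) (by positivity),
      div_le_iff₀ (by positivity), abs_of_nonneg (by linarith [hu.1])]
    change _ ≤ (1 : ℝ) * _
    linarith [hu.2]
  · exact b.integrable.comp_div (by positivity)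
  · rw [MeasureTheory.Measure.integral_comp_div (fun w => b w), smul_eq_mul, abs_of_pos (by positivity)]
    refine mul_le_mul_of_nonneg_left ?_ (by positivity)
    refine (b.integral_le_measure_closedBall _).trans ?_
    rw [MeasureTheory.Measure.real, Real.volume_closedBall, ENNReal.toReal_ofReal]
    all_goals change _ ≤ _
    all_goals simp only [b]
    all_goals norm_num

lemma tw_lower {x h : ℝ} (hx : 1 < x) {g : ℝ → ℝ} (hg0 : ∀ u, 0 ≤ g u)
    (hg1 : ∀ u ∈ Set.Icc h (h + 1), g u = 1) (hgb : ∃ B, ∀ u, g u ≤ B)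
    (hgi : MeasureTheory.Integrable g) (hh : 0 ≤ h) :
    twS h * Real.exp (-(x * (h + 1))) ≤ ∫ u, twS u * Real.exp (-(x * u)) * g u := by
  obtain ⟨B, hB⟩ := hgb
  have hi : MeasureTheory.Integrable (fun u => twS u * Real.exp (-(x * u)) * g u) :=
    (tw_integrable hx).mul_bdd (c := B) hgi.aestronglyMeasurable
      (Eventually.of_forall fun u => by rw [Real.norm_of_nonneg (hg0 u)]; exact hB u)
  have hnn : ∀ u, 0 ≤ twS u * Real.exp (-(x * u)) * g u := fun u =>
    mul_nonneg (mul_nonneg (twS_nonneg u) (Real.exp_pos _).le) (hg0 u)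
  calc twS h * Real.exp (-(x * (h + 1)))
      = ∫ u in Set.Icc h (h + 1), twS h * Real.exp (-(x * (h + 1))) := by
        simp
    _ ≤ ∫ u in Set.Icc h (h + 1), twS u * Real.exp (-(x * u)) * g u := by
        refine MeasureTheory.setIntegral_mono_on (MeasureTheory.integrableOn_const (by simp)) hi.integrableOn measurableSet_Icc ?_
        intro u hu
        rw [hg1 u hu, mul_one]
        refine mul_le_mul (twS_mono hu.1) ?_ (Real.exp_pos _).le (twS_nonneg u)
        rw [Real.exp_le_exp]
        nlinarith [hu.2]
    _ ≤ _ := MeasureTheory.setIntegral_le_integral hi (Eventually.of_forall hnn)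

lemma tw_backward {H : ℝ → ℂ} {M : ℝ} (hM : ∀ t, ‖H t‖ ≤ M)
    (hlim : ∀ φ : SchwartzMap ℝ ℂ,
    Tendsto (fun x : ℝ => ∫ u : ℝ, ((twS u * Real.exp (-(x * u)) : ℝ) : ℂ) *
      ∫ y : ℝ, φ y * Complex.exp (-(Complex.I * (y : ℂ) * (u : ℂ))))
      (nhdsWithin 1 (Set.Ioi 1))
      (nhds (∫ u : ℝ, H u *
      ∫ y : ℝ, φ y * Complex.exp (-(Complex.I * (y : ℂ) * (u : ℂ)))))) {h : ℝ} (hh : 0 ≤ h) :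
    twS h ≤ M * (2 * Real.pi * 4) * Real.exp (h + 1) := by
  obtain ⟨φ, g, hφ, hg0, hg1, hgi, hgI, B, hB⟩ := tw_test h
  have hM0 : 0 ≤ M := (norm_nonneg _).trans (hM 0)
  have hl := (hlim φ).norm
  simp_rw [hφ] at hl
  have hc : Continuous fun x : ℝ => twS h * Real.exp (-(x * (h + 1))) := by fun_prop
  have hl2 := (hc.tendsto 1).mono_left (nhdsWithin_le_nhds (s := Set.Ioi 1))
  have hle := le_of_tendsto_of_tendsto hl2 hl (by
    filter_upwards [self_mem_nhdsWithin] with x hx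
    refine (tw_lower hx hg0 hg1 ⟨B, hB⟩ hgi hh).trans ?_
    simp_rw [← Complex.ofReal_mul]
    rw [integral_complex_ofReal, Complex.norm_real]
    exact Real.le_norm_self _)
  have hr : ‖∫ u : ℝ, H u * (g u : ℂ)‖ ≤ M * (2 * Real.pi * 4) := by
    refine (MeasureTheory.norm_integral_le_of_norm_le (hgi.const_mul M)
      (Eventually.of_forall fun u => ?_)).trans ?_
    · rw [norm_mul, Complex.norm_real, Real.norm_of_nonneg (hg0 u)]
      exact mul_le_mul_of_nonneg_right (hM u) (hg0 u)
    · rw [MeasureTheory.integral_const_mul]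
      exact mul_le_mul_of_nonneg_left hgI hM0
  have := hle.trans hr
  rw [one_mul, Real.exp_neg, ← div_eq_mul_inv, div_le_iff₀ (Real.exp_pos _)] at this
  exact this

/-- Pseudomeasure criterion for the boundedness of the twin-prime counting function:
with `Λ` the von Mangoldt function, `ψ₂(N) = ∑_{n ≤ N} Λ(n)Λ(n+2)` and
`D₂(z) = ∑ Λ(n)Λ(n+2)/n^z` (which converges for `Re z > 1`), one has `ψ₂(N) = O(N)`
iff `D₂(x+iy)/(x+iy)` converges distributionally to a pseudomeasure as `x ↘ 1`. -/
theorem twin_prime_boundedness_pseudomeasure_criterion :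
    (∀ z : ℂ, 1 < z.re →
      Summable (fun n : ℕ =>
        ((Λ n * Λ (n + 2) : ℝ) : ℂ) / (n : ℂ) ^ z)) ∧
    ((∃ C : ℝ, ∀ N : ℕ, (∑ n ∈ Finset.Icc 1 N, Λ n * Λ (n + 2)) ≤ C * N) ↔
      (∃ H : ℝ → ℂ, Measurable H ∧ (∃ M : ℝ, ∀ t : ℝ, ‖H t‖ ≤ M) ∧
        ∀ φ : SchwartzMap ℝ ℂ,
          Tendsto
            (fun x : ℝ =>
              ∫ y : ℝ,
                (∑' n : ℕ, ((Λ n * Λ (n + 2) : ℝ) : ℂ) /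
                    (n : ℂ) ^ ((x : ℂ) + (y : ℂ) * Complex.I)) /
                  ((x : ℂ) + (y : ℂ) * Complex.I) * φ y)
            (nhdsWithin 1 (Set.Ioi 1))
            (nhds (∫ t : ℝ, H t *
              ∫ y : ℝ, φ y * Complex.exp (-(Complex.I * (y : ℂ) * (t : ℂ))))))) := by
  refine ⟨fun z hz => tw_summable hz, ?_⟩
  have key : ∀ φ : SchwartzMap ℝ ℂ, (fun x : ℝ => ∫ u : ℝ, ((twS u * Real.exp (-(x * u)) : ℝ) : ℂ) *
      ∫ y : ℝ, φ y * Complex.exp (-(Complex.I * (y : ℂ) * (u : ℂ)))) =ᶠ[nhdsWithin 1 (Set.Ioi 1)]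
      (fun x : ℝ =>
              ∫ y : ℝ,
                (∑' n : ℕ, ((Λ n * Λ (n + 2) : ℝ) : ℂ) /
                    (n : ℂ) ^ ((x : ℂ) + (y : ℂ) * Complex.I)) /
                  ((x : ℂ) + (y : ℂ) * Complex.I) * φ y) := by
    intro φ
    filter_upwards [self_mem_nhdsWithin] with x hx
    exact (tw_fubini hx φ).symm
  constructor
  · rintro ⟨C, hC⟩
    obtain ⟨h1, h2⟩ := tw_forward hC
    refine ⟨fun u => ((twS u * Real.exp (-u) : ℝ) : ℂ), ?_, ⟨C, h1⟩, fun φ => ?_⟩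
    · exact Complex.measurable_ofReal.comp (twS_mono.measurable.mul (by fun_prop))
    · exact (h2 φ).congr' (key φ)
  · rintro ⟨H, -, ⟨M, hM⟩, hlim⟩
    refine ⟨M * (2 * Real.pi * 4) * Real.exp 1, fun N => ?_⟩
    rcases Nat.eq_zero_or_pos N with rfl | hN
    · simp
    have hN1 : (1 : ℝ) ≤ N := by exact_mod_cast hN
    have := tw_backward hM (fun φ => (hlim φ).congr' (key φ).symm) (Real.log_nonneg hN1)
    rw [twS, Real.exp_add, Real.exp_log (by linarith), Nat.floor_natCast] at this
    refine this.trans (le_of_eq ?_)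
    ring
end
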